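/- Let S⃗ be a universe of set separations with the order function |.|_r for some non-negative non-decreasing submodular function r : 2^V → ℕ, let k ∈ ℕ, and let F be a family of stars of separations in S⃗_k that is fixed under shifting. If there exists an S_k-tree over F, then there exists an F-lean S_k-tree over F. -/

import Mathlib

open scoped Classical

noncomputable section

/-- An oriented separation of `V`: an ordered pair of subsets. -/
abbrev OSep (V : Type*) := Set V × Set V

namespace OSep

/-- The involution `(A,B)* = (B,A)`. -/
def flip {V : Type*} (s : OSep V) : OSep V := (s.2, s.1)

/-- The partial order `(A,B) ≤ (C,D) iff A ⊆ C and D ⊆ B`. -/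
def le {V : Type*} (s t : OSep V) : Prop := s.1 ⊆ t.1 ∧ t.2 ⊆ s.2

/-- The infimum `(A,B) ∧ (C,D) = (A ∩ C, B ∪ D)`. -/
def inter {V : Type*} (s t : OSep V) : OSep V := (s.1 ∩ t.1, s.2 ∪ t.2)

/-- The supremum `(A,B) ∨ (C,D) = (A ∪ C, B ∩ D)`. -/
def union {V : Type*} (s t : OSep V) : OSep V := (s.1 ∪ t.1, s.2 ∩ t.2)

end OSep

/-- A universe of set separations: a set of oriented separations (pairs covering `V`)
closed under the involution and under ∧ and ∨. -/
structure IsUniverse {V : Type*} (S : Set (OSep V)) : Prop where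
  covers : ∀ s ∈ S, s.1 ∪ s.2 = Set.univ
  flip_mem : ∀ s ∈ S, s.flip ∈ S
  inter_mem : ∀ s ∈ S, ∀ t ∈ S, s.inter t ∈ S
  union_mem : ∀ s ∈ S, ∀ t ∈ S, s.union t ∈ S

/-- An order function on a universe `S`: symmetric and submodular (non-negativity is
automatic for `ℕ`-valued functions). -/
structure IsOrderFun {V : Type*} (S : Set (OSep V)) (ord : OSep V → ℕ) : Prop where
  symm : ∀ s ∈ S, ord s.flip = ord s
  submod : ∀ s ∈ S, ∀ t ∈ S, ord (s.inter t) + ord (s.union t) ≤ ord s + ord t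

/-- A universe with an order function is grounded if `|A ∪ C, B ∩ D| ≤ |C,D|`
whenever `(B,A) ≤ (C,D)`. -/
def Grounded {V : Type*} (S : Set (OSep V)) (ord : OSep V → ℕ) : Prop :=
  ∀ s ∈ S, ∀ t ∈ S, OSep.le s.flip t → ord (s.union t) ≤ ord t

/-- A submodular function on subsets of `V`. -/
def Submodular {V : Type*} (r : Set V → ℕ) : Prop :=
  ∀ X Y : Set V, r (X ∩ Y) + r (X ∪ Y) ≤ r X + r Y

/-- The order function `|X,Y|_r = r(X) + r(Y) - r(V)` induced by `r`. -/
def ordOf {V : Type*} (r : Set V → ℕ) (s : OSep V) : ℕ := r s.1 + r s.2 - r Set.univ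

/-- A multiset of oriented separations is a star if `(A,B) ≤ (D,C)` for every two of its
members occupying distinct positions. -/
def IsStar {V : Type*} (σ : Multiset (OSep V)) : Prop :=
  ∀ a b : OSep V, (a ::ₘ {b}) ≤ σ → OSep.le a b.flip

/-- The size `⟨σ⟩_r = Σᵢ r(Bᵢ) − n · r(V)` of a star `σ = {(A₀,B₀),…,(Aₙ,Bₙ)}`. -/
def starSize {V : Type*} (r : Set V → ℕ) (σ : Multiset (OSep V)) : ℕ :=
  (σ.map fun s => r s.2).sum - (Multiset.card σ - 1) * r Set.univ

/-- `λ((A,B),(C,D)) = min { |X,Y| : (X,Y) ∈ S, (A,B) ≤ (X,Y) ≤ (C,D) }`. -/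
def lam {V : Type*} (S : Set (OSep V)) (ord : OSep V → ℕ) (a c : OSep V) : ℕ :=
  sInf (ord '' {s | s ∈ S ∧ OSep.le a s ∧ OSep.le s c})

/-- `(X,Y)` is linked to `(A,B)` if `(A,B) ≤ (X,Y)` and `|X,Y| = λ((A,B),(X,Y))`. -/
def IsLinkedSep {V : Type*} (S : Set (OSep V)) (ord : OSep V → ℕ) (a x : OSep V) : Prop :=
  x ∈ S ∧ OSep.le a x ∧ ord x = lam S ord a x

/-- `σ_t`: the multiset of labels of the oriented edges (darts) pointing towards `t`. -/
def starAt {W : Type*} [Fintype W] {V : Type*} (T : SimpleGraph W) (α : T.Dart → OSep V)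
    (t : W) : Multiset (OSep V) :=
  ((Finset.univ : Finset T.Dart).filter fun d => d.toProd.2 = t).val.map α

/-- The natural ordering on the oriented edges (darts) of a tree: `d ≤ d'` iff both lie
(in that direction) on the path from the tail of `d` to the head of `d'`. -/
def dartLE {W : Type*} (T : SimpleGraph W) (d d' : T.Dart) : Prop :=
  ∀ p : T.Walk d.toProd.1 d'.toProd.2, p.IsPath → d ∈ p.darts ∧ d' ∈ p.darts

/-- The vertex set of the subtree `T(e⃗)`: the component of `T - x` containing `y` together
with `x` itself, for `e⃗ = (x,y)`. -/
def shiftSet {W : Type*} (T : SimpleGraph W) (e : T.Dart) : Set W :=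
  {v | v = e.toProd.1 ∨ ∀ p : T.Walk e.toProd.1 v, p.IsPath → e ∈ p.darts}

/-- A dart of an induced subgraph, as a dart of the ambient graph. -/
def liftDart {W : Type*} {T : SimpleGraph W} {U : Set W} (d : (T.induce U).Dart) : T.Dart :=
  ⟨(d.toProd.1.val, d.toProd.2.val), d.adj⟩

/-- The labelling `α'` of the shift of `(T,α)` onto `(X,Y)` with respect to `e⃗`:
a dart `f` of `T(e⃗)` with `e⃗ ≤ f⃗` gets `α(f⃗) ∨ (X,Y)`, and the reverse darts get the
flipped labels. -/
def shiftAlpha {W : Type*} {V : Type*} (T : SimpleGraph W) (α : T.Dart → OSep V)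
    (e : T.Dart) (X : OSep V) : (T.induce (shiftSet T e)).Dart → OSep V :=
  fun d =>
    if dartLE T e (liftDart d) then (α (liftDart d)).union X
    else ((α (liftDart d).symm).union X).flip

/-- A family `F` of stars is fixed under shifting if for every tame `S`-tree `(T,α)`,
every oriented edge `e⃗ = (t,t')` of `T`, every vertex `s ≠ t` of `T(e⃗)` with
`α(F⃗_s) ∈ F`, and every `(X,Y)` linked to `α(e⃗)`, in the shift of `(T,α)` onto `(X,Y)`
with respect to `e⃗` one has `α'(F⃗_s) ∈ F`. -/
def FixedUnderShifting {V : Type*} (S : Set (OSep V)) (ord : OSep V → ℕ)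
    (F : Set (Multiset (OSep V))) : Prop :=
  ∀ (n : ℕ) (T : SimpleGraph (Fin n)) (α : T.Dart → OSep V) (e : T.Dart) (X : OSep V)
    (s : ↥(shiftSet T e)),
    T.IsTree → (∀ d, α d.symm = (α d).flip) → (∀ d, α d ∈ S) →
    (∀ t, IsStar (starAt T α t)) →
    (s : Fin n) ≠ e.toProd.1 → starAt T α (s : Fin n) ∈ F →
    IsLinkedSep S ord (α e) X →
    starAt (T.induce (shiftSet T e)) (shiftAlpha T α e X) s ∈ F

/-- A linked `S_k`-tree: for every two darts `e⃗ ≤ f⃗`, the minimum order of a label on the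
path from `e` to `f` equals `λ(α(e⃗), α(f⃗))`. -/
def IsLinkedTree {W : Type*} {V : Type*} (S : Set (OSep V)) (ord : OSep V → ℕ)
    (T : SimpleGraph W) (α : T.Dart → OSep V) : Prop :=
  ∀ e f : T.Dart, dartLE T e f →
    sInf ((fun g => ord (α g)) '' {g | dartLE T e g ∧ dartLE T g f}) =
      lam S ord (α e) (α f)

/-- An `F`-lean `S_k`-tree with respect to the ground function `r`. -/
def IsLeanTree {W : Type*} [Fintype W] {V : Type*} (S : Set (OSep V)) (ord : OSep V → ℕ)
    (r : Set V → ℕ) (T : SimpleGraph W) (α : T.Dart → OSep V)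
    (F : Set (Multiset (OSep V))) : Prop :=
  ∀ (t t' : W) (a b : OSep V), OSep.le a b.flip →
    (a ::ₘ starAt T α t) ∈ F → (b ::ₘ starAt T α t') ∈ F →
    (min (r a.1) (r b.1) ≤ lam S ord a b.flip ∨
      ∀ p : T.Walk t t', p.IsPath →
        sInf ((fun d => ord (α d)) '' {d | d ∈ p.darts}) = lam S ord a b.flip)

/-- `int(σ) = ⋂ᵢ Bᵢ` for `σ = {(A₀,B₀),…,(Aₙ,Bₙ)}`. -/
def intStar {V : Type*} (σ : Multiset (OSep V)) : Set V := {v | ∀ s ∈ σ, v ∈ s.2}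

/-- The universe of oriented separations of a graph `G`: pairs `(A,B)` of vertex sets with
`A ∪ B = V(G)` and no edge between `A ∖ B` and `B ∖ A`. -/
def graphSeps {V : Type*} (G : SimpleGraph V) : Set (OSep V) :=
  {s | s.1 ∪ s.2 = Set.univ ∧ ∀ a ∈ s.1 \ s.2, ∀ b ∈ s.2 \ s.1, ¬ G.Adj a b}

/-- `G` contains `k` vertex-disjoint `Z₁`–`Z₂` paths. -/
def HasDisjointPaths {V : Type*} (G : SimpleGraph V) (Z₁ Z₂ : Set V) (k : ℕ) : Prop :=
  ∃ (u v : Fin k → V) (p : ∀ i, G.Walk (u i) (v i)),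
    (∀ i, (p i).IsPath) ∧ (∀ i, u i ∈ Z₁) ∧ (∀ i, v i ∈ Z₂) ∧
    ∀ i j, i ≠ j → ∀ x, x ∈ (p i).support → x ∉ (p j).support

/-- `(T, B)` is a tree-decomposition of the graph `G`. -/
def IsTreeDecomp {V : Type*} {n : ℕ} (G : SimpleGraph V) (T : SimpleGraph (Fin n))
    (B : Fin n → Set V) : Prop :=
  T.IsTree ∧ (∀ v, ∃ t, v ∈ B t) ∧ (∀ u w, G.Adj u w → ∃ t, u ∈ B t ∧ w ∈ B t) ∧
  (∀ t₁ t₂ t₃ : Fin n, ∀ p : T.Walk t₁ t₃, p.IsPath → t₂ ∈ p.support → B t₁ ∩ B t₃ ⊆ B t₂)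

/-- The width of a tree-decomposition: `max |V_t| − 1`. -/
def tdWidth {V : Type*} {n : ℕ} (B : Fin n → Set V) : ℕ :=
  (Finset.univ.sup fun t => (B t).ncard) - 1

/-- The tree-width of a graph. -/
def treeWidth {V : Type*} (G : SimpleGraph V) : ℕ :=
  sInf {w | ∃ (n : ℕ) (T : SimpleGraph (Fin n)) (B : Fin n → Set V),
    IsTreeDecomp G T B ∧ tdWidth B = w}

/-- The path-width of a graph: minimum width of a tree-decomposition whose tree is a path. -/
def pathWidth {V : Type*} (G : SimpleGraph V) : ℕ :=
  sInf {w | ∃ (n : ℕ) (B : Fin n → Set V),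
    IsTreeDecomp G (SimpleGraph.pathGraph n) B ∧ tdWidth B = w}

/-- A linked tree-decomposition of a graph. -/
def IsLinkedDecomp {V : Type*} {n : ℕ} (G : SimpleGraph V) (T : SimpleGraph (Fin n))
    (B : Fin n → Set V) : Prop :=
  ∀ (k : ℕ) (t t' : Fin n),
    HasDisjointPaths G (B t) (B t') k ∨
    ∀ p : T.Walk t t', p.IsPath →
      ∃ d ∈ p.darts, (B d.toProd.1 ∩ B d.toProd.2).ncard < k

/-- A lean tree-decomposition of a graph. -/
def IsLeanDecomp {V : Type*} {n : ℕ} (G : SimpleGraph V) (T : SimpleGraph (Fin n))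
    (B : Fin n → Set V) : Prop :=
  ∀ (k : ℕ) (t t' : Fin n) (Z₁ Z₂ : Set V), Z₁ ⊆ B t → Z₂ ⊆ B t' →
    Z₁.ncard = k → Z₂.ncard = k →
    HasDisjointPaths G Z₁ Z₂ k ∨
    ∀ p : T.Walk t t', p.IsPath →
      ∃ d ∈ p.darts, (B d.toProd.1 ∩ B d.toProd.2).ncard < k
/-- The rank function of a matroid: `r(X)` is the maximum size of an independent subset
of `X`. -/
def mRank {α : Type*} (M : Matroid α) (X : Set α) : ℕ :=
  sSup {k | ∃ I, I ⊆ X ∧ M.Indep I ∧ I.ncard = k}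

/-- The connectivity `λ(X) = r(X) + r(E ∖ X) − r(E)` of `X ⊆ E`. -/
def mConn {α : Type*} (M : Matroid α) (X : Set α) : ℕ :=
  mRank M X + mRank M Xᶜ - mRank M Set.univ

/-- For a dart `d = (s,s')` of a tree `T`, the component of `T − s'` containing `s`. -/
def branch {W : Type*} (T : SimpleGraph W) (d : T.Dart) : Set W :=
  {w | ∀ p : T.Walk d.toProd.2 w, p.IsPath → d.toProd.1 ∈ p.support}

/-- The darts of `T` pointing towards `t`. -/
def dartsTo {W : Type*} [Fintype W] (T : SimpleGraph W) (t : W) : Finset T.Dart :=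
  Finset.univ.filter fun d => d.toProd.2 = t

/-- The width `Σᵢ r(E ∖ τ⁻¹(Tᵢ)) − (d−1)·r(E)` of the bag of a matroid tree-decomposition
at `v`, where the `Tᵢ` are the components of `T − v`. -/
def mBagWidth {α : Type*} {n : ℕ} (M : Matroid α) (T : SimpleGraph (Fin n))
    (τ : α → Fin n) (v : Fin n) : ℕ :=
  ((∑ d ∈ dartsTo T v, mRank M ((τ ⁻¹' branch T d)ᶜ)) + mRank M Set.univ)
    - (dartsTo T v).card * mRank M Set.univ

/-- The width of a matroid tree-decomposition: the maximum width of a bag. -/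
def mWidth {α : Type*} {n : ℕ} (M : Matroid α) (T : SimpleGraph (Fin n))
    (τ : α → Fin n) : ℕ :=
  Finset.univ.sup (mBagWidth M T τ)

/-- The tree-width of a matroid. -/
def matroidTreeWidth {α : Type*} (M : Matroid α) : ℕ :=
  sInf {w | ∃ (n : ℕ) (T : SimpleGraph (Fin n)) (_ : T.IsTree) (τ : α → Fin n),
    mWidth M T τ = w}

/-- `λ(Z₁,Z₂) = min {λ(X) : Z₁ ⊆ X ⊆ E ∖ Z₂}` for disjoint `Z₁, Z₂ ⊆ E`. -/
def mLam {α : Type*} (M : Matroid α) (Z₁ Z₂ : Set α) : ℕ :=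
  sInf (mConn M '' {X | Z₁ ⊆ X ∧ X ⊆ Z₂ᶜ})

/-- A lean matroid tree-decomposition. -/
def IsLeanMDecomp {α : Type*} {n : ℕ} (M : Matroid α) (T : SimpleGraph (Fin n))
    (τ : α → Fin n) : Prop :=
  ∀ (k : ℕ) (t t' : Fin n) (Z₁ Z₂ : Set α), Z₁ ⊆ τ ⁻¹' {t} → Z₂ ⊆ τ ⁻¹' {t'} →
    Disjoint Z₁ Z₂ → mRank M Z₁ = k → mRank M Z₂ = k →
    k ≤ mLam M Z₁ Z₂ ∨
    ∀ p : T.Walk t t', p.IsPath → ∃ d ∈ p.darts, mConn M (τ ⁻¹' branch T d) < k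

/-- A linked matroid tree-decomposition. -/
def IsLinkedMDecomp {α : Type*} {n : ℕ} (M : Matroid α) (T : SimpleGraph (Fin n))
    (τ : α → Fin n) : Prop :=
  ∀ e f : T.Dart, dartLE T e f →
    sInf ((fun g => mConn M (τ ⁻¹' branch T g)) '' {g | dartLE T e g ∧ dartLE T g f}) =
      sInf (mConn M '' {X | τ ⁻¹' branch T e ⊆ X ∧ X ⊆ τ ⁻¹' branch T f})
/-- Two oriented separations are nested if they have `≤`-comparable orientations. -/
def Nested {V : Type*} (s t : OSep V) : Prop :=
  OSep.le s t ∨ OSep.le s t.flip ∨ OSep.le s.flip t ∨ OSep.le s.flip t.flip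

namespace OSep

variable {V : Type*}

theorem flip_flip (s : OSep V) : s.flip.flip = s := rfl

theorem le_refl (s : OSep V) : le s s := ⟨subset_rfl, subset_rfl⟩

theorem le_trans {s t u : OSep V} (h : le s t) (h' : le t u) : le s u :=
  ⟨h.1.trans h'.1, h'.2.trans h.2⟩

theorem le_antisymm {s t : OSep V} (h : le s t) (h' : le t s) : s = t :=
  Prod.ext (h.1.antisymm h'.1) (h'.2.antisymm h.2)

theorem le_flip_comm {s t : OSep V} (h : le s t.flip) : le t s.flip := ⟨h.2, h.1⟩

theorem flip_le_flip {s t : OSep V} (h : le s t) : le t.flip s.flip := ⟨h.2, h.1⟩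

theorem inter_le_left (s t : OSep V) : le (s.inter t) s :=
  ⟨Set.inter_subset_left, Set.subset_union_left⟩

theorem inter_le_right (s t : OSep V) : le (s.inter t) t :=
  ⟨Set.inter_subset_right, Set.subset_union_right⟩

theorem le_inter {s t u : OSep V} (h : le u s) (h' : le u t) : le u (s.inter t) :=
  ⟨Set.subset_inter h.1 h'.1, Set.union_subset h.2 h'.2⟩

end OSep

section Nested

variable {V : Type*} {s t u : OSep V}

theorem Nested.flip_left (h : Nested s t) : Nested s.flip t := by
  simpa [Nested, OSep.le, OSep.flip, and_comm, or_comm, or_assoc, or_left_comm] using h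

theorem Nested.flip_right (h : Nested s t) : Nested s t.flip := by
  simpa [Nested, OSep.le, OSep.flip, and_comm, or_comm, or_assoc, or_left_comm] using h

theorem nested_flip_right_iff : Nested s t.flip ↔ Nested s t :=
  ⟨fun h => h.flip_right, fun h => h.flip_right⟩

/-- A separation nested with two crossing separations is nested with their infimum. -/
theorem Nested.inter (hst : ¬ Nested s t) (hs : Nested u s) (ht : Nested u t) :
    Nested u (s.inter t) := by
  have hl : OSep.le (s.inter t) s := OSep.inter_le_left s t
  have hr : OSep.le (s.inter t) t := OSep.inter_le_right s t
  rcases hs with hs | hs | hs | hs <;> rcases ht with ht | ht | ht | ht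
  · exact Or.inl (OSep.le_inter hs ht)
  · exact Or.inr (Or.inl (OSep.le_flip_comm (OSep.le_trans hr (OSep.le_flip_comm ht))))
  · exact absurd (Or.inr (Or.inr (Or.inl (OSep.le_trans (OSep.flip_le_flip hs) ht)))) hst
  · exact Or.inr (Or.inr (Or.inr (OSep.flip_le_flip (OSep.le_trans hr
      (OSep.flip_le_flip ht)))))
  iterate 4
    exact Or.inr (Or.inl (OSep.le_flip_comm (OSep.le_trans hl (OSep.le_flip_comm hs))))
  · exact absurd (Or.inr (Or.inr (Or.inl (OSep.le_trans (OSep.flip_le_flip hs) ht)))) hst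
  · exact Or.inr (Or.inl (OSep.le_flip_comm (OSep.le_trans hr (OSep.le_flip_comm ht))))
  · exact Or.inr (Or.inr (Or.inl (OSep.le_inter hs ht)))
  · exact Or.inr (Or.inr (Or.inr (OSep.flip_le_flip (OSep.le_trans hr
      (OSep.flip_le_flip ht)))))
  iterate 4
    exact Or.inr (Or.inr (Or.inr (OSep.flip_le_flip (OSep.le_trans hl
      (OSep.flip_le_flip hs)))))

theorem Nested.symm (h : Nested s t) : Nested t s := by
  rcases h with h | h | h | h
  · exact Or.inr (Or.inr (Or.inr (OSep.flip_le_flip h)))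
  · exact Or.inr (Or.inl (OSep.le_flip_comm h))
  · exact Or.inr (Or.inr (Or.inl (OSep.flip_le_flip h)))
  · exact Or.inl (OSep.flip_le_flip h)

end Nested

section Rank

variable {V : Type*} {r : Set V → ℕ}

theorem ordOf_flip (r : Set V → ℕ) (s : OSep V) : ordOf r s.flip = ordOf r s := by
  simp [ordOf, OSep.flip, add_comm]

theorem cast_ordOf (hsub : Submodular r) {s : OSep V} (hs : s.1 ∪ s.2 = Set.univ) :
    (ordOf r s : ℤ) = r s.1 + r s.2 - r Set.univ := by
  have := hsub s.1 s.2
  rw [hs] at this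
  unfold ordOf
  omega

/-- The order of a separation bounds the rank of every subset of its separator. -/
theorem rank_le_ordOf (hsub : Submodular r) (hmono : Monotone r) {s : OSep V}
    (hs : s.1 ∪ s.2 = Set.univ) {Z : Set V} (h₁ : Z ⊆ s.1) (h₂ : Z ⊆ s.2) :
    r Z ≤ ordOf r s := by
  have := hsub s.1 s.2
  have := hmono (Set.subset_inter h₁ h₂)
  rw [hs] at *
  unfold ordOf
  simp only at *
  omega

theorem sum_rank_sub_rank_inter_le {ι : Type*} (hsub : Submodular r) (I : Finset ι)
    (B : ι → Set V) (X : Set V)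
    (hB : ∀ i ∈ I, ∀ j ∈ I, i ≠ j → B i ∪ B j = Set.univ) :
    ∑ i ∈ I, ((r X : ℤ) - r (X ∩ B i)) ≤ r X - r (X ∩ ⋂ i ∈ I, B i) := by
  induction I using Finset.induction_on with
  | empty => simp
  | insert i I hi ih =>
    have ih := ih fun j hj l hl => hB j (Finset.mem_insert_of_mem hj) l
      (Finset.mem_insert_of_mem hl)
    rw [Finset.sum_insert hi]
    have hcov : (X ∩ B i) ∪ (X ∩ ⋂ j ∈ I, B j) = X := by
      rw [← Set.inter_union_distrib_left, Set.inter_eq_left, Set.union_iInter₂]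
      refine Set.subset_iInter₂ fun j hj => ?_
      rw [hB i (Finset.mem_insert_self i I) j (Finset.mem_insert_of_mem hj)
        (by rintro rfl; exact hi hj)]
      exact Set.subset_univ X
    have hcap : (X ∩ B i) ∩ (X ∩ ⋂ j ∈ I, B j) = X ∩ ⋂ j ∈ insert i I, B j := by
      rw [Finset.set_biInter_insert, ← Set.inter_inter_distrib_left]
    have := hsub (X ∩ B i) (X ∩ ⋂ j ∈ I, B j)
    rw [hcov, hcap] at this
    omega

theorem sum_rank_sub_rank_inter_le_of_subset {ι : Type*} (hsub : Submodular r)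
    (hmono : Monotone r) (I : Finset ι) (B : ι → Set V) {X Z : Set V}
    (hB : ∀ i ∈ I, ∀ j ∈ I, i ≠ j → B i ∪ B j = Set.univ)
    (hX : Z ⊆ X) (hZ : ∀ i ∈ I, Z ⊆ B i) :
    ∑ i ∈ I, ((r X : ℤ) - r (X ∩ B i)) ≤ r X - r Z := by
  have h := sum_rank_sub_rank_inter_le hsub I B X hB
  have : r Z ≤ r (X ∩ ⋂ i ∈ I, B i) := hmono (Set.subset_inter hX (Set.subset_iInter₂ hZ))
  omega

end Rank

section Away

variable {W : Type*} {T : SimpleGraph W} {t t' u v w : W}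

/-- Some path from `t` to `u` avoids `v`. For an edge `uv` of a tree this says that the
orientation `(u,v)` points away from `t`. -/
def Away (T : SimpleGraph W) (t u v : W) : Prop :=
  ∃ p : T.Walk t u, p.IsPath ∧ v ∉ p.support

theorem away_or_away (hT : T.Connected) (t : W) (h : T.Adj u v) :
    Away T t u v ∨ Away T t v u := by
  obtain ⟨p, hp⟩ := hT.exists_isPath t u
  by_cases hv : v ∈ p.support
  · exact Or.inr ⟨p.takeUntil v hv, hp.takeUntil hv,
      SimpleGraph.Walk.endpoint_notMem_support_takeUntil hp hv h.ne⟩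
  · exact Or.inl ⟨p, hp, hv⟩

theorem SimpleGraph.IsAcyclic.path_eq (hT : T.IsAcyclic) {p q : T.Walk u v} (hp : p.IsPath)
    (hq : q.IsPath) : p = q :=
  congrArg Subtype.val ((hT.subsingleton_path u v).elim ⟨p, hp⟩ ⟨q, hq⟩)

theorem Away.not_swap (hT : T.IsAcyclic) (h : T.Adj u v) (ha : Away T t u v) :
    ¬ Away T t v u := by
  rintro ⟨q, hq, hu⟩
  obtain ⟨p, hp, hv⟩ := ha
  have := hT.path_eq (hp.concat hv h) hq
  subst this
  simp [SimpleGraph.Walk.support_concat] at hu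

theorem away_swap_iff (hT : T.IsTree) (h : T.Adj u v) : Away T t v u ↔ ¬ Away T t u v :=
  ⟨fun ha => ha.not_swap hT.isAcyclic h.symm,
    fun ha => (away_or_away hT.connected t h).resolve_left ha⟩

theorem Away.unique (hT : T.IsAcyclic) (hu : T.Adj u w) (hv : T.Adj v w) (ha : Away T t u w)
    (hb : Away T t v w) : u = v := by
  obtain ⟨p, hp, hpw⟩ := ha
  obtain ⟨q, hq, hqw⟩ := hb
  have := hT.path_eq (hp.concat hpw hu) (hq.concat hqw hv)
  simpa using congrArg SimpleGraph.Walk.penultimate this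

theorem exists_away (hT : T.Connected) (h : t ≠ w) : ∃ u, T.Adj u w ∧ Away T t u w := by
  obtain ⟨p, hp⟩ := hT.exists_isPath w t
  cases p with
  | nil => exact absurd rfl h
  | cons e q =>
    rw [SimpleGraph.Walk.cons_isPath_iff] at hp
    exact ⟨_, e.symm, q.reverse, hp.1.reverse, by simpa using hp.2⟩

theorem away_of_mem_darts {p : T.Walk t t'} (hp : p.IsPath) {d : T.Dart} (hd : d ∈ p.darts) :
    Away T t d.fst d.snd := by
  suffices h : ∃ q : T.Walk t d.fst, q.IsPath ∧ d.snd ∉ q.support ∧ q.support ⊆ p.support by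
    obtain ⟨q, hq, hqd, -⟩ := h
    exact ⟨q, hq, hqd⟩
  induction p with
  | nil => simp at hd
  | cons e p ih =>
    rw [SimpleGraph.Walk.cons_isPath_iff] at hp
    rw [SimpleGraph.Walk.darts_cons, List.mem_cons] at hd
    rcases hd with rfl | hd
    · exact ⟨.nil, .nil, by simpa using e.ne', by simp⟩
    · obtain ⟨q, hq, hqd, hqp⟩ := ih hp.1 hd
      refine ⟨.cons e q, hq.cons fun h => hp.2 (hqp h), ?_, ?_⟩
      · rw [SimpleGraph.Walk.support_cons, List.mem_cons, not_or]
        refine ⟨fun h => hp.2 (h ▸ p.dart_snd_mem_support_of_mem_darts hd), hqd⟩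
      · simpa using List.Subset.trans hqp (List.subset_cons_self _ _)

theorem away_symm_of_mem_darts {p : T.Walk t t'} (hp : p.IsPath) {d : T.Dart}
    (hd : d ∈ p.darts) : Away T t' d.snd d.fst :=
  away_of_mem_darts (d := d.symm) hp.reverse (by simpa using hd)

theorem mem_edges_of_away (hT : T.IsAcyclic) (h : T.Adj u v) (ha : Away T t u v)
    (hb : Away T t' v u) (p : T.Walk t t') : s(u, v) ∈ p.edges := by
  obtain ⟨q, -, hq⟩ := ha
  obtain ⟨q', -, hq'⟩ := hb
  have hbr := SimpleGraph.isAcyclic_iff_forall_adj_isBridge.mp hT h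
  rw [SimpleGraph.isBridge_iff_forall_walk_mem_edges] at hbr
  have := hbr ((q.reverse.append p).append q')
  simp only [SimpleGraph.Walk.edges_append, SimpleGraph.Walk.edges_reverse, List.mem_append,
    List.mem_reverse] at this
  rcases this with (h₁ | h₁) | h₁
  · exact absurd (q.snd_mem_support_of_mem_edges h₁) hq
  · exact h₁
  · exact absurd (q'.fst_mem_support_of_mem_edges h₁) hq'

end Away

section Glue

variable {W W' : Type*} {V : Type*}

theorem Away.map {T : SimpleGraph W} {T' : SimpleGraph W'} (f : T →g T')
    (hf : Function.Injective f) {t u v : W} (h : Away T t u v) :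
    Away T' (f t) (f u) (f v) := by
  obtain ⟨p, hp, hv⟩ := h
  refine ⟨p.map f, hp.map hf, ?_⟩
  rw [SimpleGraph.Walk.support_map, List.mem_map]
  rintro ⟨w, hw, hwv⟩
  exact hv (hf hwv ▸ hw)

theorem away_iso_iff {T : SimpleGraph W} {T' : SimpleGraph W'} (f : T ≃g T') {t u v : W} :
    Away T' (f t) (f u) (f v) ↔ Away T t u v :=
  ⟨fun h => by simpa using h.map f.symm.toHom f.symm.injective,
    fun h => h.map f.toHom f.injective⟩

/-- The multiset of labels of the edges directed towards `t`, for a labelling given on pairs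
of vertices. -/
def inStar [Fintype W] (T : SimpleGraph W) (a : W → W → OSep V) (t : W) :
    Multiset (OSep V) :=
  ∑ u, if T.Adj u t then {a u t} else 0

theorem inStar_congr [Fintype W] {T : SimpleGraph W} {a b : W → W → OSep V} {t : W}
    (h : ∀ u, T.Adj u t → a u t = b u t) : inStar T a t = inStar T b t :=
  Finset.sum_congr rfl fun u _ => by
    split_ifs with hu
    · rw [h u hu]
    · rfl

theorem starAt_eq_inStar [Fintype W] {T : SimpleGraph W} {α : T.Dart → OSep V}
    {a : W → W → OSep V} (h : ∀ d, α d = a d.fst d.snd) (t : W) :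
    starAt T α t = inStar T a t := by
  have h₁ : starAt T α t = ∑ d ∈ Finset.univ.filter fun d : T.Dart => d.toProd.2 = t,
      ({α d} : Multiset (OSep V)) := by
    rw [starAt, Finset.sum, ← Multiset.sum_map_singleton (Multiset.map α _), Multiset.map_map]
    rfl
  rw [h₁, inStar, ← Finset.sum_filter]
  refine Finset.sum_bij' (fun d _ => d.fst)
    (fun u hu => ⟨(u, t), (Finset.mem_filter.mp hu).2⟩) ?_ ?_ ?_ ?_ ?_
  · intro d hd
    rw [Finset.mem_filter] at hd ⊢
    exact ⟨Finset.mem_univ _, hd.2 ▸ d.adj⟩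
  · intro u hu
    simp
  · intro d hd
    rw [Finset.mem_filter] at hd
    obtain ⟨⟨u, v⟩, huv⟩ := d
    obtain ⟨-, rfl⟩ := hd
    rfl
  · intro u hu
    rfl
  · intro d hd
    rw [Finset.mem_filter] at hd
    rw [h d, hd.2]

theorem inStar_comap [Fintype W] [Fintype W'] (T : SimpleGraph W) (a : W → W → OSep V)
    (ε : W' ≃ W) (t : W') :
    inStar (T.comap ε) (fun u v => a (ε u) (ε v)) t = inStar T a (ε t) :=
  Fintype.sum_equiv ε _ _ fun _ => rfl

theorem mem_inStar [Fintype W] {T : SimpleGraph W} {a : W → W → OSep V} {t : W}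
    {s : OSep V} : s ∈ inStar T a t ↔ ∃ u, T.Adj u t ∧ a u t = s := by
  rw [inStar, Multiset.mem_sum]
  refine ⟨fun ⟨u, _, hu⟩ => ?_, fun ⟨u, hu, hs⟩ => ⟨u, Finset.mem_univ u, by simp [hu, hs]⟩⟩
  split_ifs at hu with h
  · exact ⟨u, h, (Multiset.mem_singleton.mp hu).symm⟩
  · simp at hu

/-- Two disjoint graphs joined by an edge `uv`. -/
def glue (T : SimpleGraph W) (T' : SimpleGraph W') (u : W) (v : W') : SimpleGraph (W ⊕ W') :=
  T.sum T' ⊔ SimpleGraph.edge (Sum.inl u) (Sum.inr v)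

variable {T : SimpleGraph W} {T' : SimpleGraph W'} {u : W} {v : W'}

@[simp] theorem glue_adj_inl_inl {i j : W} :
    (glue T T' u v).Adj (Sum.inl i) (Sum.inl j) ↔ T.Adj i j := by
  simp [glue, SimpleGraph.edge_adj]

@[simp] theorem glue_adj_inr_inr {i j : W'} :
    (glue T T' u v).Adj (Sum.inr i) (Sum.inr j) ↔ T'.Adj i j := by
  simp [glue, SimpleGraph.edge_adj]

@[simp] theorem glue_adj_inl_inr {i : W} {j : W'} :
    (glue T T' u v).Adj (Sum.inl i) (Sum.inr j) ↔ i = u ∧ j = v := by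
  simp [glue, SimpleGraph.edge_adj]

@[simp] theorem glue_adj_inr_inl {i : W} {j : W'} :
    (glue T T' u v).Adj (Sum.inr j) (Sum.inl i) ↔ i = u ∧ j = v := by
  rw [SimpleGraph.adj_comm, glue_adj_inl_inr]

theorem exists_walk_of_sum_walk {i : W} {x : W ⊕ W'}
    (p : (T.sum T').Walk (Sum.inl i) x) :
    ∀ j, x = Sum.inl j → ∃ q : T.Walk i j, p.edges = q.edges.map (Sym2.map Sum.inl) := by
  suffices h : ∀ {y x : W ⊕ W'} (p : (T.sum T').Walk y x) (i j : W) (_ : y = Sum.inl i)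
      (_ : x = Sum.inl j), ∃ q : T.Walk i j, p.edges = q.edges.map (Sym2.map Sum.inl) from
    fun j hj => h p i j rfl hj
  intro y x p
  induction p with
  | nil =>
    rintro i j rfl h
    obtain rfl := Sum.inl_injective h
    exact ⟨.nil, rfl⟩
  | @cons y z x h p ih =>
    rintro i j rfl rfl
    cases z with
    | inl k =>
      obtain ⟨q, hq⟩ := ih k j rfl rfl
      exact ⟨.cons (SimpleGraph.sum_adj_inl.mp h) q, by simp [hq]⟩
    | inr k => exact absurd h (SimpleGraph.not_adj_sum_inl_inr i k)

theorem isBridge_sum_inl (hT : T.IsAcyclic) {i j : W} (h : T.Adj i j) :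
    (T.sum T').IsBridge s(Sum.inl i, Sum.inl j) := by
  rw [SimpleGraph.isBridge_iff_forall_walk_mem_edges]
  intro p
  obtain ⟨q, hq⟩ := exists_walk_of_sum_walk p j rfl
  have hbr := SimpleGraph.isAcyclic_iff_forall_adj_isBridge.mp hT h
  rw [SimpleGraph.isBridge_iff_forall_walk_mem_edges] at hbr
  rw [hq, List.mem_map]
  exact ⟨_, hbr q, rfl⟩

theorem isAcyclic_sum (hT : T.IsAcyclic) (hT' : T'.IsAcyclic) : (T.sum T').IsAcyclic := by
  rw [SimpleGraph.isAcyclic_iff_forall_adj_isBridge]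
  rintro (i | i) (j | j) h
  · exact isBridge_sum_inl hT (SimpleGraph.sum_adj_inl.mp h)
  · simp at h
  · simp at h
  · rw [SimpleGraph.isBridge_iff_forall_walk_mem_edges]
    intro p
    have hbr := isBridge_sum_inl (T' := T) hT' (SimpleGraph.sum_adj_inr.mp h)
    rw [SimpleGraph.isBridge_iff_forall_walk_mem_edges] at hbr
    let f : T.sum T' →g T'.sum T := (SimpleGraph.Iso.sumComm (G := T) (H := T')).toHom
    have hmem : s(f (Sum.inr i), f (Sum.inr j)) ∈ (p.map f).edges := hbr (p.map f)
    rw [SimpleGraph.Walk.edges_map, List.mem_map] at hmem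
    obtain ⟨e, he, hee⟩ := hmem
    rwa [Sym2.map.injective (SimpleGraph.Iso.sumComm (G := T) (H := T')).injective
      (hee.trans rfl : Sym2.map f e = Sym2.map f s(Sum.inr i, Sum.inr j))] at he

theorem isTree_glue (hT : T.IsTree) (hT' : T'.IsTree) (u : W) (v : W') :
    (glue T T' u v).IsTree where
  connected := hT.connected.sum_sup_edge hT'.connected
  isAcyclic := SimpleGraph.IsAcyclic.sup_edge_of_not_reachable
    (SimpleGraph.not_reachable_sum_inl_inr u v) (isAcyclic_sum hT.isAcyclic hT'.isAcyclic)

/-- The labelling of a glued graph in which the new edge, directed from left to right,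
has label `x`. -/
def glueLabel (a : W → W → OSep V) (b : W' → W' → OSep V) (x : OSep V) :
    W ⊕ W' → W ⊕ W' → OSep V
  | Sum.inl i, Sum.inl j => a i j
  | Sum.inr i, Sum.inr j => b i j
  | Sum.inl _, Sum.inr _ => x
  | Sum.inr _, Sum.inl _ => x.flip

theorem inStar_glue_inl [Fintype W] [Fintype W'] (a : W → W → OSep V)
    (b : W' → W' → OSep V) (x : OSep V) (s : W) :
    inStar (glue T T' u v) (glueLabel a b x) (Sum.inl s) =
      inStar T a s + if s = u then {x.flip} else 0 := by
  rw [inStar, Fintype.sum_sum_type]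
  congr 1
  · simp [inStar, glueLabel]
  · rw [Finset.sum_eq_single v]
    · simp [glueLabel]
    · intro w _ hw
      simp [hw]
    · simp

theorem inStar_glue_inr [Fintype W] [Fintype W'] (a : W → W → OSep V)
    (b : W' → W' → OSep V) (x : OSep V) (s : W') :
    inStar (glue T T' u v) (glueLabel a b x) (Sum.inr s) =
      inStar T' b s + if s = v then {x} else 0 := by
  rw [inStar, Fintype.sum_sum_type, add_comm]
  congr 1
  · simp [inStar, glueLabel]
  · rw [Finset.sum_eq_single u]
    · simp [glueLabel]
    · intro w _ hw
      simp [hw]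
    · simp

theorem glueLabel_flip {a : W → W → OSep V} {b : W' → W' → OSep V} (x : OSep V)
    (ha : ∀ i j, T.Adj i j → a j i = (a i j).flip)
    (hb : ∀ i j, T'.Adj i j → b j i = (b i j).flip) (i j : W ⊕ W')
    (h : (glue T T' u v).Adj i j) :
    glueLabel a b x j i = (glueLabel a b x i j).flip := by
  rcases i with i | i <;> rcases j with j | j
  · exact ha i j (glue_adj_inl_inl.mp h)
  · rfl
  · rfl
  · exact hb i j (glue_adj_inr_inr.mp h)

end Glue

section Shift

variable {W : Type*} {V : Type*}

/-- The labels of the shift onto `X` of a labelled tree, rooted at `t`. -/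
def shiftLabel (T : SimpleGraph W) (a : W → W → OSep V) (t : W) (X : OSep V) (u v : W) :
    OSep V :=
  if Away T t u v then (a u v).union X else ((a v u).union X).flip

theorem shiftLabel_flip {T : SimpleGraph W} (hT : T.IsTree) (a : W → W → OSep V) (t : W)
    (X : OSep V) {u v : W} (h : T.Adj u v) :
    shiftLabel T a t X v u = (shiftLabel T a t X u v).flip := by
  unfold shiftLabel
  rw [away_swap_iff hT h]
  split_ifs <;> simp_all [OSep.flip_flip]

/-- In a tree, the paths starting in a leaf `x` all begin with the edge at `x`. -/
theorem mem_darts_of_leaf {T : SimpleGraph W} {x y : W} (hxy : T.Adj x y)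
    (hleaf : ∀ z, T.Adj x z → z = y) {v : W} (hv : v ≠ x) (p : T.Walk x v) :
    (⟨(x, y), hxy⟩ : T.Dart) ∈ p.darts := by
  cases p with
  | nil => exact absurd rfl hv
  | cons h q =>
    obtain rfl := hleaf _ h
    simp

theorem dartLE_leaf_iff {T : SimpleGraph W} (hT : T.IsTree) {x y : W} (hxy : T.Adj x y)
    (hleaf : ∀ z, T.Adj x z → z = y) (d : T.Dart) :
    dartLE T ⟨(x, y), hxy⟩ d ↔ Away T x d.fst d.snd := by
  constructor
  · intro h
    by_contra hd
    obtain ⟨p, hp, hpd⟩ := (away_swap_iff hT d.adj).mpr hd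
    exact hpd (p.dart_fst_mem_support_of_mem_darts (h p hp).2)
  · rintro ⟨p, hp, hpd⟩ q hq
    obtain rfl := hT.isAcyclic.path_eq (hp.concat hpd d.adj) hq
    refine ⟨mem_darts_of_leaf hxy hleaf ?_ _, ?_⟩
    · rintro hx
      exact hpd (hx ▸ p.start_mem_support)
    · rw [SimpleGraph.Walk.darts_concat]
      simp

theorem mem_shiftSet_leaf {T : SimpleGraph W} {x y : W} (hxy : T.Adj x y)
    (hleaf : ∀ z, T.Adj x z → z = y) (v : W) : v ∈ shiftSet T ⟨(x, y), hxy⟩ := by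
  by_cases hv : v = x
  · exact Or.inl hv
  · exact Or.inr fun p _ => mem_darts_of_leaf hxy hleaf hv p

variable {S : Set (OSep V)} {ord : OSep V → ℕ} {F : Set (Multiset (OSep V))}

theorem FixedUnderShifting.inStar_fin_mem (hfix : FixedUnderShifting S ord F) {n : ℕ}
    {T : SimpleGraph (Fin n)} {a : Fin n → Fin n → OSep V} (hT : T.IsTree)
    (hflip : ∀ u v, T.Adj u v → a v u = (a u v).flip) (hS : ∀ u v, T.Adj u v → a u v ∈ S)
    (hstar : ∀ t, IsStar (inStar T a t)) {x y : Fin n} (hxy : T.Adj x y)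
    (hleaf : ∀ z, T.Adj x z → z = y) {X : OSep V} (hX : IsLinkedSep S ord (a x y) X)
    {s : Fin n} (hs : s ≠ x) (hsF : inStar T a s ∈ F) :
    inStar T (shiftLabel T a x X) s ∈ F := by
  have hstarAt := fun t => starAt_eq_inStar (T := T) (α := fun d => a d.fst d.snd) (a := a)
    (fun _ => rfl) t
  have hmem := mem_shiftSet_leaf hxy hleaf
  have h := hfix n T (fun d => a d.fst d.snd) ⟨(x, y), hxy⟩ X ⟨s, hmem s⟩ hT
    (fun d => hflip _ _ d.adj) (fun d => hS _ _ d.adj) (fun t => by rw [hstarAt]; exact hstar t)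
    hs (by rw [hstarAt]; exact hsF) hX
  rw [starAt_eq_inStar (a := fun u v => shiftLabel T a x X u.1 v.1)] at h
  · convert h using 1
    exact (Fintype.sum_equiv (Equiv.subtypeUnivEquiv hmem) _ _ fun _ => rfl).symm
  · intro d
    unfold shiftAlpha shiftLabel
    rw [dartLE_leaf_iff hT hxy hleaf]
    rfl

theorem FixedUnderShifting.inStar_leaf_mem {W : Type*} [Fintype W]
    (hfix : FixedUnderShifting S ord F)
    {T : SimpleGraph W} {a : W → W → OSep V} (hT : T.IsTree)
    (hflip : ∀ u v, T.Adj u v → a v u = (a u v).flip) (hS : ∀ u v, T.Adj u v → a u v ∈ S)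
    (hstar : ∀ t, IsStar (inStar T a t)) {x y : W} (hxy : T.Adj x y)
    (hleaf : ∀ z, T.Adj x z → z = y) {X : OSep V} (hX : IsLinkedSep S ord (a x y) X)
    {s : W} (hs : s ≠ x) (hsF : inStar T a s ∈ F) :
    inStar T (shiftLabel T a x X) s ∈ F := by
  let ε := (Fintype.equivFin W).symm
  obtain ⟨x, rfl⟩ := ε.surjective x
  obtain ⟨y, rfl⟩ := ε.surjective y
  obtain ⟨s, rfl⟩ := ε.surjective s
  let φ : T.comap ε ≃g T := SimpleGraph.Iso.comap ε T
  have h := hfix.inStar_fin_mem (T := T.comap ε) (a := fun u v => a (ε u) (ε v))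
    (φ.isTree_iff.mpr hT) (fun u v => hflip _ _) (fun u v => hS _ _)
    (fun t => by rw [inStar_comap]; exact hstar _) (x := x) (y := y) hxy
    (fun z hz => ε.injective (hleaf _ hz)) hX (s := s) (fun h => hs (congrArg ε h))
    (by rw [inStar_comap]; exact hsF)
  rw [← inStar_comap]
  convert h using 2
  funext u v
  have := away_iso_iff φ (t := x) (u := u) (v := v)
  unfold shiftLabel
  simp only [← this]
  rfl

/-- Shifting a tree over `F` along a separation `A` addable at `t`: the new leaf edge becomes
an edge with label `X` pointing towards `t`. -/
theorem FixedUnderShifting.shift_mem [Fintype W] (hfix : FixedUnderShifting S ord F)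
    (hflipS : ∀ s ∈ S, s.flip ∈ S) (hF : ∀ σ ∈ F, IsStar σ ∧ ∀ s ∈ σ, s ∈ S)
    {T : SimpleGraph W} {a : W → W → OSep V} (hT : T.IsTree)
    (hflip : ∀ u v, T.Adj u v → a v u = (a u v).flip) (hTF : ∀ t, inStar T a t ∈ F)
    {t : W} {A X : OSep V} (hA : A ::ₘ inStar T a t ∈ F) (hX : IsLinkedSep S ord A X) (s : W) :
    (inStar T (shiftLabel T a t X) s + if s = t then {X} else 0) ∈ F := by
  have hAS : A ∈ S := (hF _ hA).2 A (Multiset.mem_cons_self _ _)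
  have haS : ∀ u v, T.Adj u v → a u v ∈ S := fun u v h =>
    (hF _ (hTF v)).2 _ (mem_inStar.mpr ⟨u, h, rfl⟩)
  let T' : SimpleGraph Unit := ⊥
  have hT' : T'.IsTree := SimpleGraph.IsTree.of_subsingleton
  let b : Unit → Unit → OSep V := fun _ _ => A
  have hG := isTree_glue hT hT' t ()
  have hplus : ∀ s, inStar (glue T T' t ()) (glueLabel a b A.flip) (Sum.inl s) ∈ F := by
    intro s
    rw [inStar_glue_inl, OSep.flip_flip]
    split_ifs with h
    · subst h
      rwa [add_comm, Multiset.singleton_add]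
    · simpa using hTF s
  have key := hfix.inStar_leaf_mem (T := glue T T' t ()) (a := glueLabel a b A.flip) hG
    (glueLabel_flip _ hflip fun i j h => absurd h (by simp [T'])) ?_ ?_
    (x := Sum.inr ()) (y := Sum.inl t) (by simp) ?_ (X := X) hX (s := Sum.inl s) (by simp)
    (hplus s)
  · have hshift := inStar_glue_inl (T := T) (T' := T') (u := t) (v := ()) (shiftLabel T a t X)
      b X.flip s
    rw [OSep.flip_flip] at hshift
    rw [← hshift]
    convert key using 1
    refine inStar_congr ?_
    have hmap : ∀ u v, Away T t u v →
        Away (glue T T' t ()) (Sum.inr ()) (Sum.inl u) (Sum.inl v) := by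
      rintro u v ⟨p, hp, hv⟩
      let f : T →g glue T T' t () := ⟨Sum.inl, fun h => glue_adj_inl_inl.mpr h⟩
      have hf : Function.Injective f := Sum.inl_injective
      have hadj : (glue T T' t ()).Adj (Sum.inr ()) (f t) := glue_adj_inr_inl.mpr ⟨rfl, rfl⟩
      refine ⟨.cons hadj (p.map f), (hp.map hf).cons ?_, ?_⟩
      · simp [f]
      · simpa [f] using hv
    rintro (u | u) hu
    · rw [glue_adj_inl_inl] at hu
      have : Away (glue T T' t ()) (Sum.inr ()) (Sum.inl u) (Sum.inl s) ↔ Away T t u s := by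
        refine ⟨fun h => ?_, hmap u s⟩
        by_contra hus
        exact h.not_swap hG.isAcyclic (by simpa using hu)
          (hmap s u ((away_swap_iff hT hu).mpr hus))
      simp only [glueLabel, shiftLabel, this]
    · have : Away (glue T T' t ()) (Sum.inr ()) (Sum.inr u) (Sum.inl s) :=
        ⟨.nil, .nil, by simp⟩
      simp only [glueLabel, shiftLabel, this, if_true, OSep.flip_flip]
      obtain ⟨-, hAX, -⟩ := hX
      exact Prod.ext (Set.union_eq_right.mpr hAX.1).symm (Set.inter_eq_right.mpr hAX.2).symm
  · rintro (u | u) (v | v) h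
    · exact haS u v (glue_adj_inl_inl.mp h)
    · exact hflipS _ hAS
    · exact hAS
    · exact hAS
  · rintro (u | u)
    · exact (hF _ (hplus u)).1
    · rw [inStar_glue_inr]
      intro c d hcd
      have := Multiset.card_le_card hcd
      simp [inStar, T'] at this
  · rintro (z | z) hz
    · simpa using hz
    · simp [T'] at hz

end Shift

section Tame

variable {V : Type*} {W : Type*}

/-- A tree with edges labelled by separations of `S`, such that the labels of the edges directed
towards a common vertex form a star. -/
structure IsTame (S : Set (OSep V)) (T : SimpleGraph W) (a : W → W → OSep V) : Prop where
  isTree : T.IsTree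
  flip : ∀ u v, T.Adj u v → a v u = (a u v).flip
  mem : ∀ u v, T.Adj u v → a u v ∈ S
  star : ∀ u v s, T.Adj u s → T.Adj v s → u ≠ v → OSep.le (a u s) (a v s).flip

variable {S : Set (OSep V)} {T : SimpleGraph W} {a : W → W → OSep V} {c : OSep V}
  {x y z w t u v : W}

theorem IsTame.le_of_isPath (h : IsTame S T a) (q : T.Walk x u) (hq : q.IsPath) (Z : Set W)
    (hZ : ∀ w ∈ q.support, w ∉ Z) (hc : ∀ w, T.Adj x w → w ∉ Z → OSep.le c (a x w))
    (hvZ : v ∉ Z) (hv : v ∉ q.support) (huv : T.Adj u v) : OSep.le c (a u v) := by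
  induction q generalizing c Z with
  | nil => exact hc v huv hvZ
  | @cons x y u e q ih =>
    rw [SimpleGraph.Walk.cons_isPath_iff] at hq
    rw [SimpleGraph.Walk.support_cons, List.mem_cons, not_or] at hv
    refine OSep.le_trans (hc y e (hZ y (by simp))) (ih hq.1 {x} ?_ ?_ hv.1 hv.2 huv)
    · rintro w hw rfl
      exact hq.2 hw
    · intro w hw hwx
      rw [h.flip w y hw.symm]
      exact h.star x w y e hw.symm (Ne.symm hwx)

theorem IsTame.le_of_away (h : IsTame S T a) (hc : ∀ u, T.Adj t u → OSep.le c (a t u))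
    (huv : T.Adj u v) (ha : Away T t u v) : OSep.le c (a u v) := by
  obtain ⟨q, hq, hv⟩ := ha
  exact h.le_of_isPath q hq ∅ (fun _ _ => id) (fun w hw _ => hc w hw) id hv huv

theorem IsTame.nested (h : IsTame S T a) (hxy : T.Adj x y) (hzw : T.Adj z w) :
    Nested (a x y) (a z w) := by
  wlog hxz : Away T z x y generalizing x y
  · have := this hxy.symm ((away_swap_iff h.isTree hxy).mpr hxz)
    rw [h.flip x y hxy] at this
    exact this.flip_left
  obtain ⟨q, hq, hy⟩ : ∃ q : T.Walk x z, q.IsPath ∧ y ∉ q.support :=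
    let ⟨q, hq, hy⟩ := hxz
    ⟨q.reverse, hq.reverse, by simpa using hy⟩
  have hstart : ∀ v, T.Adj x v → v ∉ ({y} : Set W) → OSep.le (a y x) (a x v) := by
    intro v hv hvy
    rw [h.flip v x hv.symm]
    exact h.star y v x hxy.symm hv.symm (Ne.symm hvy)
  by_cases hwy : w = y
  · subst hwy
    by_cases hzx : z = x
    · subst hzx
      exact Or.inl (OSep.le_refl _)
    · exact Or.inr (Or.inl (h.star x z w hxy hzw (Ne.symm hzx)))
  have hyq : ∀ v ∈ q.support, v ∉ ({y} : Set W) := by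
    rintro v hv rfl
    exact hy hv
  suffices hs : Nested (a y x) (a z w) by
    rw [h.flip x y hxy] at hs
    exact hs.flip_left
  by_cases hw : w ∈ q.support
  · have hle := h.le_of_isPath (q.takeUntil w hw) (hq.takeUntil hw) {y}
      (fun v hv => hyq v (q.support_takeUntil_subset_support hw hv)) hstart
      (hyq z q.end_mem_support)
      (SimpleGraph.Walk.endpoint_notMem_support_takeUntil hq hw hzw.ne) hzw.symm
    rw [h.flip z w hzw] at hle
    exact Or.inr (Or.inl hle)
  · exact Or.inl (h.le_of_isPath q hq {y} hyq hstart hwy hw hzw)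

end Tame

section Size

variable {V : Type*} {W : Type*} {r : Set V → ℕ}

/-- The size of a star of separations; an integer-valued form of `starSize`. -/
def size (r : Set V → ℕ) (σ : Multiset (OSep V)) : ℤ :=
  r Set.univ - (σ.map fun s => (r Set.univ - r s.2 : ℤ)).sum

theorem size_inStar_add [Fintype W] (T : SimpleGraph W) (a : W → W → OSep V) (s : W)
    (τ : Multiset (OSep V)) : size r (inStar T a s + τ) =
      size r τ - ∑ u with T.Adj u s, (r Set.univ - r (a u s).2 : ℤ) := by
  have : ((inStar T a s).map fun s => (r Set.univ - r s.2 : ℤ)).sum =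
      ∑ u with T.Adj u s, (r Set.univ - r (a u s).2 : ℤ) := by
    rw [inStar, Finset.sum_filter, ← Multiset.coe_mapAddMonoidHom,
      ← Multiset.coe_sumAddMonoidHom, map_sum, map_sum]
    refine Finset.sum_congr rfl fun u _ => ?_
    split_ifs <;> simp
  rw [size, size, Multiset.map_add, Multiset.sum_add, this]
  ring

theorem size_inStar [Fintype W] (T : SimpleGraph W) (a : W → W → OSep V) (s : W) :
    size r (inStar T a s) =
      r Set.univ - ∑ u with T.Adj u s, (r Set.univ - r (a u s).2 : ℤ) := by
  rw [← add_zero (inStar T a s), size_inStar_add]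
  simp [size]

theorem size_inStar_add_singleton [Fintype W] (T : SimpleGraph W) (a : W → W → OSep V) (s : W)
    (X : OSep V) : size r (inStar T a s + {X}) =
      r X.2 - ∑ u with T.Adj u s, (r Set.univ - r (a u s).2 : ℤ) := by
  rw [size_inStar_add]
  simp [size]

theorem size_inStar_add_le [Fintype W] (hmono : Monotone r) (T : SimpleGraph W)
    (a : W → W → OSep V) {u s : W} (hu : T.Adj u s) (τ : Multiset (OSep V)) :
    size r (inStar T a s + τ) ≤ r (a u s).2 + size r τ - r Set.univ := by
  rw [size_inStar_add]
  have := Finset.single_le_sum (s := Finset.univ.filter fun u => T.Adj u s)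
    (f := fun u => (r Set.univ - r (a u s).2 : ℤ))
    (fun v _ => by have := hmono (Set.subset_univ (a v s).2); omega)
    (Finset.mem_filter.mpr ⟨Finset.mem_univ u, hu⟩)
  omega

theorem size_inStar_add_le_of_ne [Fintype W] (hmono : Monotone r) (T : SimpleGraph W)
    (a : W → W → OSep V) {u v s : W} (hu : T.Adj u s) (hv : T.Adj v s) (huv : u ≠ v)
    (τ : Multiset (OSep V)) :
    size r (inStar T a s + τ) ≤
      r (a u s).2 + r (a v s).2 + size r τ - 2 * r Set.univ := by
  rw [size_inStar_add]
  have := Finset.add_le_sum (s := Finset.univ.filter fun u => T.Adj u s)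
    (f := fun u => (r Set.univ - r (a u s).2 : ℤ))
    (fun v _ => by have := hmono (Set.subset_univ (a v s).2); omega)
    (Finset.mem_filter.mpr ⟨Finset.mem_univ u, hu⟩)
    (Finset.mem_filter.mpr ⟨Finset.mem_univ v, hv⟩) huv
  omega

variable {S : Set (OSep V)} {T : SimpleGraph W} {a : W → W → OSep V}

theorem IsTame.union_eq_univ (h : IsTame S T a) (hcov : ∀ s ∈ S, s.1 ∪ s.2 = Set.univ)
    {i j s : W} (hi : T.Adj i s) (hj : T.Adj j s) (hij : i ≠ j) :
    (a i s).2 ∪ (a j s).2 = Set.univ := by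
  rw [Set.eq_univ_iff_forall]
  intro v
  have hv : v ∈ (a j s).1 ∪ (a j s).2 := by
    rw [hcov _ (h.mem j s hj)]
    exact Set.mem_univ v
  exact hv.imp (fun hv => (h.star i j s hi hj hij).2 hv) id

theorem IsTame.rank_le_size [Fintype W] (h : IsTame S T a)
    (hcov : ∀ s ∈ S, s.1 ∪ s.2 = Set.univ) (hsub : Submodular r) (hmono : Monotone r) {s : W}
    {Z : Set V} (hZ : ∀ u, T.Adj u s → Z ⊆ (a u s).2) :
    (r Z : ℤ) ≤ size r (inStar T a s) := by
  have := sum_rank_sub_rank_inter_le_of_subset hsub hmono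
    (Finset.univ.filter fun u => T.Adj u s) (fun u => (a u s).2) (X := Set.univ) (Z := Z)
    (fun i hi j hj hij => h.union_eq_univ hcov (by simpa using hi) (by simpa using hj) hij)
    (Set.subset_univ Z) (fun i hi => hZ i (by simpa using hi))
  simp only [Set.univ_inter] at this
  rw [size_inStar]
  omega

theorem IsTame.ordOf_le_size [Fintype W] (h : IsTame S T a)
    (hcov : ∀ s ∈ S, s.1 ∪ s.2 = Set.univ) (hsub : Submodular r) (hmono : Monotone r) {u s : W}
    (hu : T.Adj u s) : (ordOf r (a u s) : ℤ) ≤ size r (inStar T a s) := by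
  have hmem : u ∈ Finset.univ.filter fun u => T.Adj u s := by simpa using hu
  have := sum_rank_sub_rank_inter_le_of_subset hsub hmono
    ((Finset.univ.filter fun u => T.Adj u s).erase u) (fun u => (a u s).2) (X := Set.univ)
    (Z := (a u s).1)
    (fun i hi j hj hij => h.union_eq_univ hcov (by simp_all) (by simp_all) hij)
    (Set.subset_univ _)
    (fun i hi => (h.star i u s (by simp_all) hu (Finset.ne_of_mem_erase hi)).2)
  simp only [Set.univ_inter] at this
  rw [size_inStar, ← Finset.add_sum_erase _ _ hmem, cast_ordOf hsub (hcov _ (h.mem u s hu))]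
  omega

end Size

section ShiftStar

variable {V : Type*} {W : Type*} {r : Set V → ℕ} {S : Set (OSep V)} {T : SimpleGraph W}
  {a : W → W → OSep V} {X : OSep V} {t s u : W}

/-- The stars of the tree obtained by shifting onto `X` from `t`, where a new edge with label
`X` points towards `t`. -/
def shiftStar [Fintype W] (T : SimpleGraph W) (a : W → W → OSep V) (t : W) (X : OSep V)
    (s : W) : Multiset (OSep V) :=
  inStar T (shiftLabel T a t X) s + if s = t then {X} else 0

theorem shiftLabel_snd_of_away (h : Away T t u s) :
    (shiftLabel T a t X u s).2 = (a u s).2 ∩ X.2 := by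
  rw [shiftLabel, if_pos h]
  rfl

theorem IsTame.shiftLabel_snd_of_not_away (h : IsTame S T a) (hu : T.Adj u s)
    (ha : ¬ Away T t u s) : (shiftLabel T a t X u s).2 = (a u s).2 ∪ X.1 := by
  rw [shiftLabel, if_neg ha, h.flip u s hu]
  rfl

theorem not_away_self : ¬ Away T t u t := fun ⟨p, _, hp⟩ => hp p.start_mem_support

theorem IsTame.sum_rank_union_le (h : IsTame S T a)
    (hcov : ∀ s ∈ S, s.1 ∪ s.2 = Set.univ) (hsub : Submodular r) (hmono : Monotone r)
    (I : Finset W) (hI : ∀ i ∈ I, T.Adj i s) {Y Z : Set V} (hZY : Z ⊆ Y)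
    (hZ : ∀ i ∈ I, Z ⊆ (a i s).2) :
    ∑ i ∈ I, ((r ((a i s).2 ∪ Y) : ℤ) - r (a i s).2) ≤ r Y - r Z := by
  refine (Finset.sum_le_sum fun i _ => ?_).trans
    (sum_rank_sub_rank_inter_le_of_subset hsub hmono I (fun u => (a u s).2) (X := Y) (Z := Z)
    (fun i hi j hj hij => h.union_eq_univ hcov (hI i hi) (hI j hj) hij) hZY hZ)
  have := hsub (a i s).2 Y
  rw [Set.inter_comm] at this
  omega

variable [Fintype W] {c : OSep V}

theorem IsTame.size_shiftStar_self_add_le (h : IsTame S T a)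
    (hcov : ∀ s ∈ S, s.1 ∪ s.2 = Set.univ) (hsub : Submodular r) (hmono : Monotone r)
    (hX : X ∈ S) (hc : ∀ u, T.Adj t u → OSep.le c (a t u)) (hcX : OSep.le c X) :
    size r (shiftStar T a t X t) + r c.1 ≤ size r (inStar T a t) + ordOf r X := by
  have hsum := h.sum_rank_union_le hcov hsub hmono (Finset.univ.filter fun u => T.Adj u t)
    (fun i hi => by simpa using hi) hcX.1 fun i hi => by
      have hi : T.Adj i t := by simpa using hi
      have := (hc i hi.symm).1
      rwa [h.flip i t hi] at this
  have hcongr : ∑ u with T.Adj u t, (r Set.univ - r (shiftLabel T a t X u t).2 : ℤ) =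
      ∑ u with T.Adj u t, (r Set.univ - r (a u t).2 : ℤ) -
      ∑ u with T.Adj u t, ((r ((a u t).2 ∪ X.1) : ℤ) - r (a u t).2) := by
    rw [← Finset.sum_sub_distrib]
    refine Finset.sum_congr rfl fun u hu => ?_
    rw [h.shiftLabel_snd_of_not_away (by simpa using hu) not_away_self]
    ring
  rw [shiftStar, if_pos rfl, size_inStar_add_singleton, size_inStar, hcongr,
    cast_ordOf hsub (hcov X hX)]
  omega

theorem IsTame.size_shiftStar_add_le (h : IsTame S T a)
    (hcov : ∀ s ∈ S, s.1 ∪ s.2 = Set.univ) (hinter : ∀ s ∈ S, ∀ t ∈ S, s.inter t ∈ S)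
    (hsub : Submodular r) (hmono : Monotone r)
    (hX : X ∈ S) (hst : s ≠ t) (hu : T.Adj u s) (ha : Away T t u s) :
    size r (shiftStar T a t X s) + ordOf r (X.inter (a u s)) ≤
      size r (inStar T a s) + ordOf r X := by
  have hmem : u ∈ Finset.univ.filter fun u => T.Adj u s := by simpa using hu
  have hsum := h.sum_rank_union_le hcov hsub hmono
    ((Finset.univ.filter fun u => T.Adj u s).erase u)
    (fun i hi => by simp_all) (Y := X.1) (Z := X.1 ∩ (a u s).1) Set.inter_subset_left
    (fun i hi => Set.inter_subset_right.trans
      (h.star i u s (by simp_all) hu (Finset.ne_of_mem_erase hi)).2)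
  have hcongr : ∑ u ∈ (Finset.univ.filter fun u => T.Adj u s).erase u,
        (r Set.univ - r (shiftLabel T a t X u s).2 : ℤ) =
      ∑ u ∈ (Finset.univ.filter fun u => T.Adj u s).erase u, (r Set.univ - r (a u s).2 : ℤ) -
      ∑ u ∈ (Finset.univ.filter fun u => T.Adj u s).erase u,
        ((r ((a u s).2 ∪ X.1) : ℤ) - r (a u s).2) := by
    rw [← Finset.sum_sub_distrib]
    refine Finset.sum_congr rfl fun v hv => ?_
    have hv' : T.Adj v s := by simp_all
    rw [h.shiftLabel_snd_of_not_away hv' fun hav => Finset.ne_of_mem_erase hv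
      (Away.unique h.isTree.isAcyclic hv' hu hav ha)]
    ring
  have hB := hsub (a u s).2 X.2
  have hord := cast_ordOf hsub (hcov _ (hinter X hX _ (h.mem u s hu)))
  have : ((X.inter (a u s)).2 : Set V) = (a u s).2 ∪ X.2 := Set.union_comm _ _
  rw [this, show (X.inter (a u s)).1 = X.1 ∩ (a u s).1 from rfl] at hord
  rw [shiftStar, if_neg hst, add_zero, size_inStar, size_inStar, ← Finset.add_sum_erase _ _ hmem,
    ← Finset.add_sum_erase _ (fun u => (r Set.univ - r (a u s).2 : ℤ)) hmem, hcongr, hord,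
    shiftLabel_snd_of_away ha, cast_ordOf hsub (hcov X hX)]
  omega

end ShiftStar

section Obstruction

variable {V : Type*} {W : Type*} {r : Set V → ℕ} {S : Set (OSep V)} {T : SimpleGraph W}
  {a : W → W → OSep V} {X c b : OSep V} {t t' s u v : W}

/-- The separation `X` witnesses that a tame tree is not lean, where `c` and `b` are addable at
`t` and `t'`; moreover `X` crosses as few labels as possible. -/
structure IsLeanObstruction (S : Set (OSep V)) (r : Set V → ℕ) (T : SimpleGraph W)
    (a : W → W → OSep V) (t t' : W) (c b X : OSep V) : Prop where
  tame : IsTame S T a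
  le_label : ∀ u, T.Adj t u → OSep.le c (a t u)
  le_label' : ∀ u, T.Adj t' u → OSep.le b (a t' u)
  mem : X ∈ S
  le_sep : OSep.le c X
  le_sep' : OSep.le b X.flip
  ordOf_le : ∀ Y ∈ S, OSep.le c Y → OSep.le b Y.flip → ordOf r X ≤ ordOf r Y
  lt_rank : ordOf r X < r c.1
  lt_rank' : ordOf r X < r b.1
  lt_ordOf : ∀ u v, T.Adj u v → Away T t u v → Away T t' v u → ordOf r X < ordOf r (a u v)
  nested : ∀ u v, T.Adj u v → OSep.le c (a u v) → ordOf r (X.inter (a u v)) ≤ ordOf r X →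
    Nested (a u v) X
  nested' : ∀ u v, T.Adj u v → OSep.le b (a u v) →
    ordOf r (X.flip.inter (a u v)) ≤ ordOf r X → Nested (a u v) X

namespace IsLeanObstruction

theorem symm (H : IsLeanObstruction S r T a t t' c b X) (hU : IsUniverse S) :
    IsLeanObstruction S r T a t' t b c X.flip where
  tame := H.tame
  le_label := H.le_label'
  le_label' := H.le_label
  mem := hU.flip_mem X H.mem
  le_sep := H.le_sep'
  le_sep' := H.le_sep
  ordOf_le Y hY hb hc := by
    rw [ordOf_flip, ← ordOf_flip r Y]
    exact H.ordOf_le _ (hU.flip_mem Y hY) hc hb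
  lt_rank := by simpa only [ordOf_flip] using H.lt_rank'
  lt_rank' := by simpa only [ordOf_flip] using H.lt_rank
  lt_ordOf u v h ha ha' := by
    have := H.lt_ordOf v u h.symm ha' ha
    rwa [H.tame.flip u v h, ordOf_flip, ← ordOf_flip r X] at this
  nested u v h hb ho := (H.nested' u v h hb (by simpa only [ordOf_flip] using ho)).flip_right
  nested' u v h hb ho :=
    (H.nested u v h hb (by rwa [OSep.flip_flip, ordOf_flip] at ho)).flip_right

theorem ordOf_le_ordOf_inter (H : IsLeanObstruction S r T a t t' c b X) (hU : IsUniverse S)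
    (hu : T.Adj u s) (ha : Away T t u s) : ordOf r X ≤ ordOf r (X.inter (a u s)) :=
  H.ordOf_le _ (hU.inter_mem X H.mem _ (H.tame.mem u s hu))
    (OSep.le_inter H.le_sep (H.tame.le_of_away H.le_label hu ha))
    (OSep.le_trans H.le_sep' (OSep.flip_le_flip (OSep.inter_le_left X (a u s))))

variable [Fintype W]

theorem size_self_lt (H : IsLeanObstruction S r T a t t' c b X) (hU : IsUniverse S)
    (hsub : Submodular r) (hmono : Monotone r) :
    size r (shiftStar T a t X t) < size r (inStar T a t) := by
  have := H.tame.size_shiftStar_self_add_le hU.covers hsub hmono H.mem H.le_label H.le_sep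
  have := H.lt_rank
  omega

theorem size_le (H : IsLeanObstruction S r T a t t' c b X) (hU : IsUniverse S)
    (hsub : Submodular r) (hmono : Monotone r) (s : W) :
    size r (shiftStar T a t X s) ≤ size r (inStar T a s) := by
  by_cases hst : s = t
  · subst hst
    exact (H.size_self_lt hU hsub hmono).le
  · obtain ⟨u, hu, ha⟩ := exists_away H.tame.isTree.connected (Ne.symm hst)
    have := H.tame.size_shiftStar_add_le hU.covers hU.inter_mem hsub hmono H.mem hst hu ha
    have := H.ordOf_le_ordOf_inter hU hu ha
    omega

theorem le_label_of_size_eq (H : IsLeanObstruction S r T a t t' c b X) (hU : IsUniverse S)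
    (hsub : Submodular r) (hmono : Monotone r) (hu : T.Adj u s) (ha : Away T t u s)
    (heq : size r (shiftStar T a t X s) = size r (inStar T a s))
    (hlt : (ordOf r X : ℤ) < size r (inStar T a s)) : OSep.le X (a u s) := by
  have hst : s ≠ t := by
    rintro rfl
    exact not_away_self ha
  have hcov := hU.covers X H.mem
  have hshift := H.tame.size_shiftStar_add_le hU.covers hU.inter_mem hsub hmono H.mem hst hu ha
  have hca := H.tame.le_of_away H.le_label hu ha
  rcases (H.nested u s hu hca (by omega)).symm with h | h | h | h
  · exact h
  · have := rank_le_ordOf hsub hmono hcov H.le_sep.1 (hca.1.trans h.2)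
    exact absurd H.lt_rank this.not_gt
  · have : size r (shiftStar T a t X s) ≤ ordOf r X := by
      have hle := size_inStar_add_le hmono T (shiftLabel T a t X) hu 0
      rw [shiftLabel_snd_of_away ha] at hle
      have := rank_le_ordOf hsub hmono hcov (Z := (a u s).2 ∩ X.2)
        (Set.inter_subset_left.trans h.2) Set.inter_subset_right
      rw [shiftStar, if_neg hst]
      simp only [size, Multiset.map_zero, Multiset.sum_zero] at hle ⊢
      omega
    omega
  · by_cases ha' : Away T t' u s
    · have := rank_le_ordOf hsub hmono hcov
        ((H.tame.le_of_away H.le_label' hu ha').1.trans h.2) H.le_sep'.1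
      exact absurd H.lt_rank' this.not_gt
    · have hlt' := H.lt_ordOf u s hu ha ((away_swap_iff H.tame.isTree hu).mpr ha')
      have : X.inter (a u s) = a u s :=
        Prod.ext (Set.inter_eq_right.mpr h.2) (Set.union_eq_right.mpr h.1)
      rw [this] at hshift
      omega

theorem size_symm_le_of_le_label (H : IsLeanObstruction S r T a t t' c b X) (hU : IsUniverse S)
    (hsub : Submodular r) (hmono : Monotone r) (hu : T.Adj u s) (hle : OSep.le X (a u s)) :
    size r (shiftStar T a t' X.flip s) ≤ ordOf r X := by
  have hcov := hU.covers X H.mem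
  by_cases ha' : Away T t' u s
  · have hst : s ≠ t' := by
      rintro rfl
      exact not_away_self ha'
    have h := size_inStar_add_le hmono T (shiftLabel T a t' X.flip) hu 0
    rw [shiftLabel_snd_of_away ha'] at h
    have := rank_le_ordOf hsub hmono hcov (Z := (a u s).2 ∩ X.flip.2)
      Set.inter_subset_right (Set.inter_subset_left.trans hle.2)
    rw [shiftStar, if_neg hst]
    simp only [size, Multiset.map_zero, Multiset.sum_zero] at h ⊢
    omega
  · have hlabel : (shiftLabel T a t' X.flip u s).2 = X.2 := by
      rw [H.tame.shiftLabel_snd_of_not_away hu ha']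
      exact Set.union_eq_right.mpr hle.2
    have hord := cast_ordOf hsub hcov
    by_cases hst : s = t'
    · have h := size_inStar_add_le hmono T (shiftLabel T a t' X.flip) hu {X.flip}
      rw [hlabel] at h
      rw [shiftStar, if_pos hst]
      have : size r {X.flip} = r X.1 := by simp [size, OSep.flip]
      omega
    · obtain ⟨v, hv, hav⟩ := exists_away H.tame.isTree.connected (Ne.symm hst)
      have h := size_inStar_add_le_of_ne hmono T (shiftLabel T a t' X.flip) hu hv
        (by rintro rfl; exact ha' hav) 0
      rw [hlabel, shiftLabel_snd_of_away hav] at h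
      have : r ((a v s).2 ∩ X.flip.2) ≤ r X.1 := hmono Set.inter_subset_right
      rw [shiftStar, if_neg hst]
      simp only [size, Multiset.map_zero, Multiset.sum_zero] at h ⊢
      omega

theorem size_symm_le_of_size_eq (H : IsLeanObstruction S r T a t t' c b X) (hU : IsUniverse S)
    (hsub : Submodular r) (hmono : Monotone r)
    (heq : size r (shiftStar T a t X s) = size r (inStar T a s))
    (hlt : (ordOf r X : ℤ) < size r (inStar T a s)) :
    size r (shiftStar T a t' X.flip s) ≤ ordOf r X := by
  have hst : t ≠ s := by
    rintro rfl
    exact (H.size_self_lt hU hsub hmono).ne heq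
  obtain ⟨u, hu, ha⟩ := exists_away H.tame.isTree.connected hst
  exact H.size_symm_le_of_le_label hU hsub hmono hu
    (H.le_label_of_size_eq hU hsub hmono hu ha heq hlt)

theorem exists_size_lt (H : IsLeanObstruction S r T a t t' c b X) (hU : IsUniverse S)
    (hsub : Submodular r) (hmono : Monotone r) :
    ∃ s, (ordOf r X : ℤ) < size r (inStar T a s) ∧
      size r (shiftStar T a t X s) < size r (inStar T a s) ∧
      size r (shiftStar T a t' X.flip s) < size r (inStar T a s) := by
  have H' := H.symm hU
  by_contra! hno
  have hle := H.size_le hU hsub hmono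
  have hle' := H'.size_le hU hsub hmono
  have hsize : (ordOf r X : ℤ) < size r (inStar T a t') := by
    have hb : ∀ u, T.Adj u t' → b.1 ⊆ (a u t').2 := fun u hu => by
      have := (H.le_label' u hu.symm).1
      rwa [H.tame.flip u t' hu] at this
    have := H.tame.rank_le_size hU.covers hsub hmono hb
    have := H.lt_rank'
    omega
  obtain ⟨p, hp⟩ := H.tame.isTree.connected.exists_isPath t t'
  let P : Set W := {s | size r (shiftStar T a t X s) < size r (inStar T a s)}
  have ht : t ∈ P := H.size_self_lt hU hsub hmono
  have ht' : t' ∉ P := fun h => absurd (H'.size_self_lt hU hsub hmono) (hno t' hsize h).not_gt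
  obtain ⟨⟨⟨u, v⟩, huv⟩, hd, hu, hv⟩ := p.exists_boundary_dart P ht ht'
  replace huv : T.Adj u v := huv
  have hauv : Away T t u v := away_of_mem_darts hp hd
  have havu : Away T t' v u := away_symm_of_mem_darts hp hd
  have hord := H.lt_ordOf u v huv hauv havu
  have hsv := H.tame.ordOf_le_size hU.covers hsub hmono huv
  have hsu := H.tame.ordOf_le_size hU.covers hsub hmono huv.symm
  rw [H.tame.flip u v huv, ordOf_flip] at hsu
  have h₁ := H.le_label_of_size_eq hU hsub hmono huv hauv
    (le_antisymm (hle v) (not_lt.mp hv)) (by omega)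
  have h₂ := H'.le_label_of_size_eq hU hsub hmono huv.symm havu
    (le_antisymm (hle' u) (hno u (by omega) hu)) (by rw [ordOf_flip]; omega)
  rw [H.tame.flip u v huv] at h₂
  rw [OSep.le_antisymm h₁ (OSep.flip_le_flip h₂)] at hord
  exact lt_irrefl _ hord

end IsLeanObstruction

end Obstruction

theorem isDershowitzMannaLT_sum {W : Type*} [Fintype W] {f g h : W → ℕ} (m : ℕ)
    (hg : ∀ s, g s ≤ f s) (hh : ∀ s, h s ≤ f s) (hgh : ∀ s, m < f s → g s = f s → h s ≤ m)
    (hhg : ∀ s, m < f s → h s = f s → g s ≤ m)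
    (hex : ∃ s, m < f s ∧ g s < f s ∧ h s < f s) :
    Multiset.IsDershowitzMannaLT (∑ s, ({g s} + {h s} : Multiset ℕ)) (∑ s, {f s}) := by
  obtain ⟨s₀, hs₀, hgs₀, hhs₀⟩ := hex
  let D : W → Prop := fun s => m < f s ∧ (g s = f s ∨ h s = f s)
  have hD₀ : ¬ D s₀ := fun hD => hD.2.elim hgs₀.ne hhs₀.ne
  have hmem : ∀ s, ¬ D s → f s ∈ ∑ s with ¬ D s, ({f s} : Multiset ℕ) := fun s hs =>
    Multiset.mem_sum.mpr ⟨s, by simpa using hs, Multiset.mem_singleton_self _⟩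
  refine ⟨∑ s with D s, {f s}, ∑ s with D s, {if g s = f s then h s else g s} +
    ∑ s with ¬ D s, ({g s} + {h s}), ∑ s with ¬ D s, {f s}, ?_, ?_, ?_, ?_⟩
  · intro h
    have := hmem s₀ hD₀
    rw [h] at this
    simp at this
  · rw [← Finset.sum_filter_add_sum_filter_not Finset.univ D, ← add_assoc,
      ← Finset.sum_add_distrib]
    congr 1
    refine Finset.sum_congr rfl fun s hs => ?_
    have hs : D s := by simpa using hs
    split_ifs with hgs
    · rw [hgs]
    · rw [hs.2.resolve_left hgs, add_comm]
  · rw [Finset.sum_filter_add_sum_filter_not]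
  · intro y hy
    have hsmall : y ≤ m → ∃ z ∈ ∑ s with ¬ D s, ({f s} : Multiset ℕ), y < z := fun hy =>
      ⟨f s₀, hmem s₀ hD₀, hy.trans_lt hs₀⟩
    rw [Multiset.mem_add, Multiset.mem_sum, Multiset.mem_sum] at hy
    rcases hy with ⟨s, hs, hy⟩ | ⟨s, hs, hy⟩
    · have hs : D s := by simpa using hs
      rw [Multiset.mem_singleton] at hy
      apply hsmall
      split_ifs at hy with hgs
      · exact hy ▸ hgh s hs.1 hgs
      · exact hy ▸ hhg s hs.1 (hs.2.resolve_left hgs)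
    · have hs : ¬ D s := by simpa using hs
      rw [Multiset.mem_add, Multiset.mem_singleton, Multiset.mem_singleton] at hy
      by_cases hm : m < f s
      · refine ⟨f s, hmem s hs, ?_⟩
        have hs' : ¬ g s = f s ∧ ¬ h s = f s := not_or.mp fun h => hs ⟨hm, h⟩
        have := hg s
        have := hh s
        omega
      · apply hsmall
        have := hg s
        have := hh s
        omega

section Leanness

variable {V : Type*} {W : Type*} {r : Set V → ℕ} {S : Set (OSep V)} {T : SimpleGraph W}
  {a : W → W → OSep V} {X c b : OSep V} {t t' : W} {F : Set (Multiset (OSep V))}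

/-- The number of labels of a tree, counted with direction, that are nested with `X`. -/
def nestedCount [Fintype W] (T : SimpleGraph W) (a : W → W → OSep V) (X : OSep V) : ℕ :=
  (Finset.univ.filter fun p : W × W => T.Adj p.1 p.2 ∧ Nested (a p.1 p.2) X).card

theorem nestedCount_flip [Fintype W] (T : SimpleGraph W) (a : W → W → OSep V) (X : OSep V) :
    nestedCount T a X.flip = nestedCount T a X := by
  simp only [nestedCount, nested_flip_right_iff]

theorem IsTame.nestedCount_lt_inter [Fintype W] (h : IsTame S T a) {u v : W} (huv : T.Adj u v)
    (hX : ¬ Nested (a u v) X) : nestedCount T a X < nestedCount T a (X.inter (a u v)) := by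
  refine Finset.card_lt_card ((Finset.ssubset_iff_of_subset ?_).mpr ⟨(u, v), ?_, ?_⟩)
  · rintro ⟨i, j⟩ hij
    simp only [Finset.mem_filter, Finset.mem_univ, true_and] at hij ⊢
    exact ⟨hij.1, Nested.inter (fun hX' => hX hX'.symm) hij.2 (h.nested hij.1 huv)⟩
  · simp only [Finset.mem_filter, Finset.mem_univ, true_and]
    exact ⟨huv, Nested.symm (Or.inl (OSep.inter_le_right X (a u v)))⟩
  · simp [hX]

theorem IsTame.nested_of_maximal [Fintype W] (h : IsTame S T a) (hU : IsUniverse S)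
    (hX : X ∈ S) (hcX : OSep.le c X) (hbX : OSep.le b X.flip)
    (hmin : ∀ Y ∈ S, OSep.le c Y → OSep.le b Y.flip → ordOf r X ≤ ordOf r Y)
    (hmax : ∀ Y ∈ S, OSep.le c Y → OSep.le b Y.flip → ordOf r Y = ordOf r X →
      nestedCount T a Y ≤ nestedCount T a X) {u v : W} (huv : T.Adj u v)
    (hc : OSep.le c (a u v)) (hord : ordOf r (X.inter (a u v)) ≤ ordOf r X) :
    Nested (a u v) X := by
  by_contra hn
  have hS := hU.inter_mem X hX _ (h.mem u v huv)
  have hcY := OSep.le_inter hcX hc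
  have hbY := OSep.le_trans hbX (OSep.flip_le_flip (OSep.inter_le_left X (a u v)))
  exact (h.nestedCount_lt_inter huv hn).not_ge
    (hmax _ hS hcY hbY (le_antisymm hord (hmin _ hS hcY hbY)))

theorem ordOf_eq_lam {ord : OSep V → ℕ} {C : OSep V} (hX : X ∈ S) (hcX : OSep.le c X)
    (hXC : OSep.le X C)
    (hmin : ∀ Y ∈ S, OSep.le c Y → OSep.le Y C → ord X ≤ ord Y) : ord X = lam S ord c C := by
  refine le_antisymm (le_csInf ⟨_, X, ⟨hX, hcX, hXC⟩, rfl⟩ ?_)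
    (Nat.sInf_le ⟨X, ⟨hX, hcX, hXC⟩, rfl⟩)
  rintro _ ⟨Y, ⟨hY, hcY, hYC⟩, rfl⟩
  exact hmin Y hY hcY hYC

theorem IsTame.exists_obstruction [Fintype V] [Fintype W] (h : IsTame S T a)
    (hU : IsUniverse S) (hcS : c ∈ S) (hcb : OSep.le c b.flip)
    (hc : ∀ u, T.Adj t u → OSep.le c (a t u)) (hb : ∀ u, T.Adj t' u → OSep.le b (a t' u))
    (hlt : lam S (ordOf r) c b.flip < r c.1) (hlt' : lam S (ordOf r) c b.flip < r b.1)
    (hpath : ∀ u v, T.Adj u v → Away T t u v → Away T t' v u →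
      ordOf r (a u v) ≠ lam S (ordOf r) c b.flip) :
    ∃ X, IsLeanObstruction S r T a t t' c b X := by
  set m := lam S (ordOf r) c b.flip with hm
  have hmin : ∀ Y ∈ S, OSep.le c Y → OSep.le b Y.flip → m ≤ ordOf r Y := fun Y hY hcY hbY =>
    Nat.sInf_le ⟨Y, ⟨hY, hcY, OSep.le_flip_comm hbY⟩, rfl⟩
  obtain ⟨X₀, ⟨hX₀, hcX₀, hX₀b⟩, hX₀m⟩ := Nat.sInf_mem
    (s := ordOf r '' {s | s ∈ S ∧ OSep.le c s ∧ OSep.le s b.flip})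
    ⟨_, c, ⟨hcS, OSep.le_refl c, hcb⟩, rfl⟩
  obtain ⟨X, ⟨hX, hcX, hbX, hXm⟩, hmax⟩ := (Set.toFinite
    {Y | Y ∈ S ∧ OSep.le c Y ∧ OSep.le b Y.flip ∧ ordOf r Y = m}).exists_maximalFor
    (nestedCount T a) _ ⟨X₀, hX₀, hcX₀, OSep.le_flip_comm hX₀b, hX₀m⟩
  have hmax' : ∀ Y ∈ S, OSep.le c Y → OSep.le b Y.flip → ordOf r Y = m →
      nestedCount T a Y ≤ nestedCount T a X := fun Y hY hcY hbY hYm =>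
    (le_total _ _).elim id (hmax ⟨hY, hcY, hbY, hYm⟩)
  rw [← hXm] at hmin hmax' hlt hlt' hpath
  refine ⟨X, h, hc, hb, hX, hcX, hbX, hmin, hlt, hlt', fun u v huv hu hv => ?_,
    fun u v huv => h.nested_of_maximal hU hX hcX hbX hmin hmax' huv, fun u v huv hbu hord => ?_⟩
  · have hbv := h.le_of_away hb huv.symm hv
    rw [h.flip u v huv] at hbv
    exact (hmin _ (h.mem u v huv) (h.le_of_away hc huv hu) hbv).lt_of_ne' (hpath u v huv hu hv)
  · rw [← nested_flip_right_iff]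
    refine h.nested_of_maximal hU (hU.flip_mem X hX) hbX hcX ?_ ?_ huv hbu
      (by rwa [ordOf_flip r X])
    · intro Y hY hbY hcY
      rw [ordOf_flip, ← ordOf_flip r Y]
      exact hmin _ (hU.flip_mem Y hY) hcY hbY
    · intro Y hY hbY hcY hYX
      rw [nestedCount_flip, ← nestedCount_flip T a Y]
      exact hmax' _ (hU.flip_mem Y hY) hcY hbY (by rw [ordOf_flip, hYX, ordOf_flip])

theorem IsLeanObstruction.isLinkedSep (H : IsLeanObstruction S r T a t t' c b X) :
    IsLinkedSep S (ordOf r) c X :=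
  ⟨H.mem, H.le_sep, ordOf_eq_lam H.mem H.le_sep (OSep.le_refl X) fun Y hY hcY hYX =>
    H.ordOf_le Y hY hcY (OSep.le_trans H.le_sep' (OSep.flip_le_flip hYX))⟩

/-- A tree labelled by separations all of whose stars lie in `F`. -/
structure IsTreeOver [Fintype W] (F : Set (Multiset (OSep V))) (T : SimpleGraph W)
    (a : W → W → OSep V) : Prop where
  isTree : T.IsTree
  flip : ∀ u v, T.Adj u v → a v u = (a u v).flip
  mem : ∀ t, inStar T a t ∈ F

theorem IsTreeOver.isTame [Fintype W] (h : IsTreeOver F T a)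
    (hF : ∀ σ ∈ F, IsStar σ ∧ ∀ s ∈ σ, s ∈ S) : IsTame S T a where
  isTree := h.isTree
  flip := h.flip
  mem u v huv := (hF _ (h.mem v)).2 _ (mem_inStar.mpr ⟨u, huv, rfl⟩)
  star u v s hu hv huv := by
    refine (hF _ (h.mem s)).1 _ _ ?_
    have := Finset.sum_le_sum_of_subset
      (f := fun u => if T.Adj u s then ({a u s} : Multiset (OSep V)) else 0)
      (Finset.subset_univ {u, v})
    rw [Finset.sum_pair huv, if_pos hu, if_pos hv] at this
    exact this

theorem IsTreeOver.le_label [Fintype W] (h : IsTreeOver F T a)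
    (hF : ∀ σ ∈ F, IsStar σ ∧ ∀ s ∈ σ, s ∈ S) (hc : c ::ₘ inStar T a t ∈ F) {u : W}
    (hu : T.Adj t u) : OSep.le c (a t u) := by
  rw [h.flip u t hu.symm]
  refine (hF _ hc).1 _ _ (Multiset.cons_le_cons c (Multiset.singleton_le.mpr ?_))
  exact mem_inStar.mpr ⟨u, hu.symm, rfl⟩

/-- The multiset of the sizes of the stars of a labelled tree. -/
def sizes [Fintype W] (r : Set V → ℕ) (T : SimpleGraph W) (a : W → W → OSep V) :
    Multiset ℕ :=
  ∑ s, {(size r (inStar T a s)).toNat}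

theorem IsTreeOver.comap {W' : Type*} [Fintype W] [Fintype W'] (h : IsTreeOver F T a)
    (ε : W' ≃ W) : IsTreeOver F (T.comap ε) (fun u v => a (ε u) (ε v)) where
  isTree := (SimpleGraph.Iso.comap ε T).isTree_iff.mpr h.isTree
  flip u v := h.flip (ε u) (ε v)
  mem t := by
    rw [inStar_comap]
    exact h.mem (ε t)

theorem sizes_comap {W' : Type*} [Fintype W] [Fintype W'] (T : SimpleGraph W)
    (a : W → W → OSep V) (ε : W' ≃ W) :
    sizes r (T.comap ε) (fun u v => a (ε u) (ε v)) = sizes r T a :=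
  Fintype.sum_equiv ε _ _ fun s => by rw [inStar_comap]

theorem IsLeanObstruction.exists_sizes_lt [Fintype W]
    (H : IsLeanObstruction S r T a t t' c b X) (hU : IsUniverse S) (hsub : Submodular r)
    (hmono : Monotone r) (hF : ∀ σ ∈ F, IsStar σ ∧ ∀ s ∈ σ, s ∈ S)
    (hfix : FixedUnderShifting S (ordOf r) F) (h : IsTreeOver F T a)
    (hc : c ::ₘ inStar T a t ∈ F) (hb : b ::ₘ inStar T a t' ∈ F) :
    ∃ (T' : SimpleGraph (W ⊕ W)) (a' : W ⊕ W → W ⊕ W → OSep V), IsTreeOver F T' a' ∧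
      Multiset.IsDershowitzMannaLT (sizes r T' a') (sizes r T a) := by
  have H' := H.symm hU
  let T' := glue T T t t'
  let a' := glueLabel (shiftLabel T a t X) (shiftLabel T a t' X.flip) X.flip
  have hl : ∀ s, inStar T' a' (Sum.inl s) = shiftStar T a t X s := fun s => by
    rw [inStar_glue_inl]
    rfl
  have hr : ∀ s, inStar T' a' (Sum.inr s) = shiftStar T a t' X.flip s := fun s =>
    inStar_glue_inr _ _ _ _
  refine ⟨T', a', ⟨isTree_glue h.isTree h.isTree t t', ?_, ?_⟩, ?_⟩
  · exact glueLabel_flip X.flip (fun i j hij => shiftLabel_flip h.isTree a t X hij)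
      (fun i j hij => shiftLabel_flip h.isTree a t' X.flip hij)
  · rintro (s | s)
    · rw [hl]
      exact hfix.shift_mem hU.flip_mem hF h.isTree h.flip h.mem hc H.isLinkedSep s
    · rw [hr]
      exact hfix.shift_mem hU.flip_mem hF h.isTree h.flip h.mem hb H'.isLinkedSep s
  · rw [sizes, Fintype.sum_sum_type, ← Finset.sum_add_distrib]
    simp only [hl, hr]
    have hle := H.size_le hU hsub hmono
    have hle' := H'.size_le hU hsub hmono
    refine isDershowitzMannaLT_sum (ordOf r X) (fun s => Int.toNat_le_toNat (hle s))
      (fun s => Int.toNat_le_toNat (hle' s)) ?_ ?_ ?_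
    · intro s hs heq
      have := H.size_symm_le_of_size_eq hU hsub hmono (s := s) (by omega) (by omega)
      omega
    · intro s hs heq
      have := H'.size_symm_le_of_size_eq hU hsub hmono (s := s) (by omega)
        (by rw [ordOf_flip]; omega)
      rw [ordOf_flip, OSep.flip_flip] at this
      omega
    · obtain ⟨s, hs, hs₁, hs₂⟩ := H.exists_size_lt hU hsub hmono
      exact ⟨s, by omega, by omega, by omega⟩

theorem IsTreeOver.exists_obstruction [Fintype V] [Fintype W] (h : IsTreeOver F T a)
    (hU : IsUniverse S) (hF : ∀ σ ∈ F, IsStar σ ∧ ∀ s ∈ σ, s ∈ S)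
    (hlean : ¬ IsLeanTree S (ordOf r) r T (fun d => a d.fst d.snd) F) :
    ∃ t t' c b X, c ::ₘ inStar T a t ∈ F ∧ b ::ₘ inStar T a t' ∈ F ∧
      IsLeanObstruction S r T a t t' c b X := by
  have hstar := fun t => starAt_eq_inStar (T := T) (α := fun d => a d.fst d.snd) (a := a)
    (fun _ => rfl) t
  have htame := h.isTame hF
  unfold IsLeanTree at hlean
  simp only [hstar] at hlean
  push Not at hlean
  obtain ⟨t, t', c, b, hcb, hc, hb, hlt, p, hp, hne⟩ := hlean
  have hcS := (hF _ hc).2 c (Multiset.mem_cons_self _ _)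
  have hle := fun u (hu : T.Adj t u) => h.le_label hF hc hu
  have hle' := fun u (hu : T.Adj t' u) => h.le_label hF hb hu
  refine ⟨t, t', c, b, ?_⟩
  suffices hX : ∃ X, IsLeanObstruction S r T a t t' c b X from
    hX.imp fun X hX => ⟨hc, hb, hX⟩
  refine htame.exists_obstruction hU hcS hcb hle hle' (lt_min_iff.mp hlt).1
    (lt_min_iff.mp hlt).2 fun u v huv hu hv heq => hne ?_
  have hmem : ordOf r (a u v) ∈
      (fun d : T.Dart => ordOf r (a d.fst d.snd)) '' {d | d ∈ p.darts} := by
    obtain ⟨d, hd, hde⟩ := List.mem_map.mp (mem_edges_of_away h.isTree.isAcyclic huv hu hv p)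
    refine ⟨d, hd, ?_⟩
    obtain ⟨⟨i, j⟩, hij⟩ := d
    rcases SimpleGraph.dart_edge_eq_mk'_iff'.mp hde with ⟨rfl, rfl⟩ | ⟨rfl, rfl⟩
    · rfl
    · simp only [h.flip _ _ huv, ordOf_flip]
  refine le_antisymm (heq ▸ Nat.sInf_le hmem) (le_csInf ⟨_, hmem⟩ ?_)
  rintro _ ⟨d, hd, rfl⟩
  have h₁ := htame.le_of_away hle d.adj (away_of_mem_darts hp hd)
  have h₂ := htame.le_of_away hle' d.adj.symm (away_symm_of_mem_darts hp hd)
  rw [h.flip _ _ d.adj] at h₂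
  exact Nat.sInf_le ⟨_, ⟨htame.mem _ _ d.adj, h₁, OSep.le_flip_comm h₂⟩, rfl⟩

theorem IsTreeOver.exists_isLeanTree [Fintype V] (hU : IsUniverse S) (hsub : Submodular r)
    (hmono : Monotone r) (hF : ∀ σ ∈ F, IsStar σ ∧ ∀ s ∈ σ, s ∈ S)
    (hfix : FixedUnderShifting S (ordOf r) F) {n : ℕ} {T : SimpleGraph (Fin n)}
    {a : Fin n → Fin n → OSep V} (h : IsTreeOver F T a) :
    ∃ (n : ℕ) (T : SimpleGraph (Fin n)) (a : Fin n → Fin n → OSep V),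
      IsTreeOver F T a ∧ IsLeanTree S (ordOf r) r T (fun d => a d.fst d.snd) F := by
  have hwf : WellFounded (Multiset.IsDershowitzMannaLT (α := ℕ)) :=
    Multiset.wellFounded_isDershowitzMannaLT
  generalize hM : sizes r T a = M
  induction M using hwf.induction generalizing n with
  | _ M ih =>
    subst hM
    by_contra hno
    obtain ⟨t, t', c, b, X, hc, hb, H⟩ :=
      h.exists_obstruction hU hF fun hlean => hno ⟨n, T, a, h, hlean⟩
    obtain ⟨T', a', h', hlt⟩ := H.exists_sizes_lt hU hsub hmono hF hfix h hc hb
    rw [← sizes_comap T' a' finSumFinEquiv.symm] at hlt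
    exact hno (ih _ hlt (h'.comap finSumFinEquiv.symm) rfl)

end Leanness

/-- Let `S⃗` be a universe of set separations with the order function
`|.|_r` for a non-negative, non-decreasing, submodular `r`, `k ∈ ℕ`, and `F` a family of
stars of separations in `S⃗_k` fixed under shifting. If there exists an `S_k`-tree over `F`,
then there exists an `F`-lean `S_k`-tree over `F`. -/
theorem exists_lean_Sk_tree {V : Type*} [Fintype V] (S : Set (OSep V)) (r : Set V → ℕ)
    (k : ℕ) (hU : IsUniverse S) (hsub : Submodular r) (hmono : Monotone r)
    (F : Set (Multiset (OSep V)))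
    (hF : ∀ σ ∈ F, IsStar σ ∧ ∀ s ∈ σ, s ∈ S ∧ ordOf r s < k)
    (hfix : FixedUnderShifting S (ordOf r) F)
    (hex : ∃ (n : ℕ) (T : SimpleGraph (Fin n)) (α : T.Dart → OSep V),
      T.IsTree ∧ (∀ d, α d.symm = (α d).flip) ∧ (∀ d, α d ∈ S ∧ ordOf r (α d) < k) ∧
      (∀ t, starAt T α t ∈ F)) :
    ∃ (n : ℕ) (T : SimpleGraph (Fin n)) (α : T.Dart → OSep V),
      T.IsTree ∧ (∀ d, α d.symm = (α d).flip) ∧ (∀ d, α d ∈ S ∧ ordOf r (α d) < k) ∧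
      (∀ t, starAt T α t ∈ F) ∧ IsLeanTree S (ordOf r) r T α F := by
  have hF' : ∀ σ ∈ F, IsStar σ ∧ ∀ s ∈ σ, s ∈ S := fun σ hσ =>
    ⟨(hF σ hσ).1, fun s hs => ((hF σ hσ).2 s hs).1⟩
  obtain ⟨n, T, α, hT, hflip, -, hmem⟩ := hex
  let a : Fin n → Fin n → OSep V := fun u v => if h : T.Adj u v then α ⟨(u, v), h⟩ else (∅, ∅)
  have ha : ∀ d, α d = a d.fst d.snd := fun d => by simp [a, d.adj]
  have hover : IsTreeOver F T a :=
    ⟨hT, fun u v h => by rw [← ha ⟨(u, v), h⟩, ← ha ⟨(v, u), h.symm⟩, ← hflip]; rfl,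
      fun t => starAt_eq_inStar ha t ▸ hmem t⟩
  obtain ⟨n, T, a, h, hlean⟩ := hover.exists_isLeanTree hU hsub hmono hF' hfix
  refine ⟨n, T, fun d => a d.fst d.snd, h.isTree, fun d => h.flip _ _ d.adj, fun d => ?_,
    fun t => ?_, hlean⟩
  · exact (hF _ (h.mem d.snd)).2 _ (mem_inStar.mpr ⟨d.fst, d.adj, rfl⟩)
  · rw [starAt_eq_inStar fun _ => rfl]
    exact h.mem t
end
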